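/- arXiv:2002.09990 — 7 statements merged into one kernel-verified Lean document; each statement's English description precedes it below -/
import Mathlib

section
/- Let X and M be real Hilbert spaces, let a : X × X → ℝ and b : X × M → ℝ be bounded bilinear forms, and let V := {v ∈ X : b(v,q) = 0 for all q ∈ M}. Assume there is a constant C_a > 0 such that a(w,w) ≥ C_a^{-1}‖w‖_X² for all w ∈ V (coercivity on V), and a constant C_b > 0 such that inf_{q ∈ M, q ≠ 0} sup_{v ∈ X, v ≠ 0} b(v,q)/(‖v‖_X ‖q‖_M) ≥ C_b^{-1} (the Babuška–Brezzi inf-sup condition). Then for every f ∈ X' and g ∈ M' there exists a unique pair (u,p) ∈ X × M such that a(u,v) + b(v,p) = f(v) for all v ∈ X and b(u,q) = g(q) for all q ∈ M; moreover ‖u‖_X ≤ C_a‖f‖_{X'} + C_b(1 + ‖a‖C_a)‖g‖_{M'} and ‖p‖_M ≤ C_b(1 + ‖a‖C_a)‖f‖_{X'} + ‖a‖C_b²(1 + ‖a‖C_a)‖g‖_{M'}, where ‖a‖ denotes the operator norm of the bilinear form a. -/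
open scoped BigOperators

open InnerProductSpace in
/-- The Lax-Milgram theorem for functionals. -/
theorem IsCoercive.exists_forall_eq {V : Type*} [NormedAddCommGroup V] [InnerProductSpace ℝ V]
    [CompleteSpace V] {B : V →L[ℝ] V →L[ℝ] ℝ} (hB : IsCoercive B) (l : V →L[ℝ] ℝ) :
    ∃ u, ∀ v, B u v = l v := by
  refine ⟨hB.continuousLinearEquivOfBilin.symm ((toDual ℝ V).symm l), fun v => ?_⟩
  rw [← hB.continuousLinearEquivOfBilin_apply, ContinuousLinearEquiv.apply_symm_apply,
    toDual_symm_apply]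

section MixedProblem

variable {X M : Type*} [NormedAddCommGroup X] [InnerProductSpace ℝ X]
  [NormedAddCommGroup M] [InnerProductSpace ℝ M]

theorem norm_le_mul_norm_of_infsup {b : X →L[ℝ] M →L[ℝ] ℝ} {C : ℝ} (hC : 0 < C)
    (h : ∀ q : M, q ≠ 0 → C⁻¹ ≤ ⨆ v : X, b v q / (‖v‖ * ‖q‖)) {K : ℝ} (hK : 0 ≤ K) (q : M)
    (hq : ∀ v, b v q ≤ K * ‖v‖) : ‖q‖ ≤ C * K := by
  rcases eq_or_ne q 0 with rfl | hq0
  · simpa using mul_nonneg hC.le hK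
  have hpos := norm_pos_iff.2 hq0
  have hsup : C⁻¹ ≤ K / ‖q‖ := (h q hq0).trans <| Real.iSup_le (fun v => by
    rcases eq_or_ne v 0 with rfl | hv
    · simp only [norm_zero, zero_mul, div_zero]
      positivity
    · have hv := norm_pos_iff.2 hv
      rw [div_le_div_iff₀ (by positivity) hpos]
      nlinarith [mul_le_mul_of_nonneg_right (hq v) hpos.le]) (by positivity)
  rw [inv_eq_one_div, div_le_div_iff₀ hC hpos] at hsup
  linarith

variable [CompleteSpace X]

open InnerProductSpace in
/-- The operator `T : M → X` with `⟪T q, v⟫ = b v q`. -/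
noncomputable def rieszOfBilin (b : X →L[ℝ] M →L[ℝ] ℝ) : M →L[ℝ] X :=
  LinearMap.mkContinuous
    { toFun := fun q => (toDual ℝ X).symm (b.flip q)
      map_add' := by simp
      map_smul' := by simp } ‖b.flip‖ fun q => by
    simpa using b.flip.le_opNorm q

theorem inner_rieszOfBilin (b : X →L[ℝ] M →L[ℝ] ℝ) (q : M) (v : X) :
    inner ℝ (rieszOfBilin b q) v = b v q := by
  simp [rieszOfBilin]

theorem norm_le_mul_norm_rieszOfBilin {b : X →L[ℝ] M →L[ℝ] ℝ} {C : ℝ} (hC : 0 < C)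
    (h : ∀ q : M, q ≠ 0 → C⁻¹ ≤ ⨆ v : X, b v q / (‖v‖ * ‖q‖)) (q : M) :
    ‖q‖ ≤ C * ‖rieszOfBilin b q‖ :=
  norm_le_mul_norm_of_infsup hC h (norm_nonneg _) q fun v => by
    rw [← inner_rieszOfBilin]
    exact real_inner_le_norm _ _

variable [CompleteSpace M]

theorem exists_rieszOfBilin_eq {b : X →L[ℝ] M →L[ℝ] ℝ} {C : ℝ} (hC : 0 < C)
    (h : ∀ q : M, q ≠ 0 → C⁻¹ ≤ ⨆ v : X, b v q / (‖v‖ * ‖q‖)) (g : M →L[ℝ] ℝ) :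
    ∃ m : M, ∀ q, b (rieszOfBilin b m) q = g q := by
  refine IsCoercive.exists_forall_eq (B := b.comp (rieszOfBilin b))
    ⟨(C ^ 2)⁻¹, by positivity, fun q => ?_⟩ g
  have hq := norm_le_mul_norm_rieszOfBilin hC h q
  rw [ContinuousLinearMap.comp_apply, ← inner_rieszOfBilin, real_inner_self_eq_norm_sq, mul_assoc,
    inv_mul_le_iff₀ (by positivity), ← mul_pow, ← sq]
  gcongr

/-- A right inverse of `b` bounded by the inf-sup constant. -/
theorem exists_lift_norm_le {b : X →L[ℝ] M →L[ℝ] ℝ} {C : ℝ} (hC : 0 < C)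
    (h : ∀ q : M, q ≠ 0 → C⁻¹ ≤ ⨆ v : X, b v q / (‖v‖ * ‖q‖)) (g : M →L[ℝ] ℝ) :
    ∃ u : X, (∀ q, b u q = g q) ∧ ‖u‖ ≤ C * ‖g‖ := by
  obtain ⟨m, hm⟩ := exists_rieszOfBilin_eq hC h g
  refine ⟨rieszOfBilin b m, hm, ?_⟩
  have hsq : ‖rieszOfBilin b m‖ ^ 2 = g m := by
    rw [← hm, ← inner_rieszOfBilin, real_inner_self_eq_norm_sq]
  have hg := (le_abs_self _).trans (g.le_opNorm m)
  have hmn := mul_le_mul_of_nonneg_left (norm_le_mul_norm_rieszOfBilin hC h m) (norm_nonneg g)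
  rcases (norm_nonneg (rieszOfBilin b m)).eq_or_lt with h0 | h0
  · rw [← h0]
    positivity
  · refine le_of_mul_le_mul_right ?_ h0
    linarith

/-- A functional vanishing on the kernel of `b` is of the form `b · p`. -/
theorem exists_eq_of_vanishing_on_ker {b : X →L[ℝ] M →L[ℝ] ℝ} {C : ℝ} (hC : 0 < C)
    (h : ∀ q : M, q ≠ 0 → C⁻¹ ≤ ⨆ v : X, b v q / (‖v‖ * ‖q‖)) (l : X →L[ℝ] ℝ)
    (hl : ∀ w, (∀ q, b w q = 0) → l w = 0) : ∃ p : M, ∀ v, b v p = l v := by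
  set r := (InnerProductSpace.toDual ℝ X).symm l with hr
  have hrl : ∀ v, inner ℝ r v = l v := fun v => by simp [hr]
  obtain ⟨m, hm⟩ := exists_rieszOfBilin_eq hC h (b r)
  have hker : ∀ q, b (r - rieszOfBilin b m) q = 0 := fun q => by simp [hm]
  have hzero : r - rieszOfBilin b m = 0 := by
    rw [← inner_self_eq_zero (𝕜 := ℝ), inner_sub_left, hrl, hl _ hker, inner_rieszOfBilin, hker,
      sub_zero]
  refine ⟨m, fun v => ?_⟩
  rw [← inner_rieszOfBilin, ← sub_eq_zero.1 hzero, hrl]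

theorem mixed_problem_exists {a : X →L[ℝ] X →L[ℝ] ℝ} {b : X →L[ℝ] M →L[ℝ] ℝ} {Ca Cb : ℝ}
    (hCa : 0 < Ca) (hCb : 0 < Cb)
    (hcoer : ∀ w : X, (∀ q : M, b w q = 0) → Ca⁻¹ * ‖w‖ ^ 2 ≤ a w w)
    (hinfsup : ∀ q : M, q ≠ 0 → Cb⁻¹ ≤ ⨆ v : X, b v q / (‖v‖ * ‖q‖))
    (f : X →L[ℝ] ℝ) (g : M →L[ℝ] ℝ) :
    ∃ u p, (∀ v : X, a u v + b v p = f v) ∧ ∀ q : M, b u q = g q := by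
  obtain ⟨u₀, hu₀, -⟩ := exists_lift_norm_le hCb hinfsup g
  let V : Submodule ℝ X := b.ker
  have hV : ∀ w, w ∈ V ↔ ∀ q, b w q = 0 := fun w => by
    simp [V, LinearMap.mem_ker, ContinuousLinearMap.ext_iff]
  have : CompleteSpace V := b.isClosed_ker.completeSpace_coe
  obtain ⟨w, hw⟩ := IsCoercive.exists_forall_eq
    (B := (a.bilinearComp V.subtypeL V.subtypeL))
    ⟨Ca⁻¹, by positivity, fun w => by
      simpa [sq, mul_assoc] using hcoer w ((hV w).1 w.2)⟩ ((f - a u₀).comp V.subtypeL)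
  obtain ⟨p, hp⟩ := exists_eq_of_vanishing_on_ker hCb hinfsup (f - a (u₀ + w)) fun v hv => by
    have := hw ⟨v, (hV v).2 hv⟩
    simp at this ⊢
    linarith
  refine ⟨u₀ + w, p, fun v => by simp [hp], fun q => ?_⟩
  simp [hu₀]

theorem mixed_problem_norm_le {a : X →L[ℝ] X →L[ℝ] ℝ} {b : X →L[ℝ] M →L[ℝ] ℝ} {Ca Cb : ℝ}
    (hCa : 0 < Ca) (hCb : 0 < Cb)
    (hcoer : ∀ w : X, (∀ q : M, b w q = 0) → Ca⁻¹ * ‖w‖ ^ 2 ≤ a w w)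
    (hinfsup : ∀ q : M, q ≠ 0 → Cb⁻¹ ≤ ⨆ v : X, b v q / (‖v‖ * ‖q‖))
    {f : X →L[ℝ] ℝ} {g : M →L[ℝ] ℝ} {u : X} {p : M}
    (h₁ : ∀ v : X, a u v + b v p = f v) (h₂ : ∀ q : M, b u q = g q) :
    ‖u‖ ≤ Ca * ‖f‖ + Cb * (1 + ‖a‖ * Ca) * ‖g‖ ∧
      ‖p‖ ≤ Cb * (1 + ‖a‖ * Ca) * ‖f‖ + ‖a‖ * Cb ^ 2 * (1 + ‖a‖ * Ca) * ‖g‖ := by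
  obtain ⟨u₀, hu₀, hn⟩ := exists_lift_norm_le hCb hinfsup g
  have hker : ∀ q, b (u - u₀) q = 0 := fun q => by simp [h₂, hu₀]
  have hval : a (u - u₀) (u - u₀) = f (u - u₀) - a u₀ (u - u₀) := by
    rw [← h₁, hker, map_sub a, sub_apply]
    ring
  have hw : ‖u - u₀‖ ≤ Ca * (‖f‖ + ‖a‖ * ‖u₀‖) := by
    rcases (norm_nonneg (u - u₀)).eq_or_lt with h0 | h0
    · rw [← h0]
      positivity
    have hc := hcoer _ hker
    rw [hval, inv_mul_le_iff₀ hCa] at hc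
    have hf := (le_abs_self _).trans (f.le_opNorm (u - u₀))
    have ha := (neg_le_abs _).trans (a.le_opNorm₂ u₀ (u - u₀))
    refine le_of_mul_le_mul_right ?_ h0
    calc ‖u - u₀‖ * ‖u - u₀‖ = ‖u - u₀‖ ^ 2 := (sq _).symm
      _ ≤ Ca * (f (u - u₀) - a u₀ (u - u₀)) := hc
      _ ≤ Ca * ((‖f‖ + ‖a‖ * ‖u₀‖) * ‖u - u₀‖) := by
        gcongr
        linarith
      _ = _ := by ring
  have hu : ‖u‖ ≤ Ca * ‖f‖ + Cb * (1 + ‖a‖ * Ca) * ‖g‖ := calc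
    ‖u‖ = ‖u₀ + (u - u₀)‖ := by rw [add_sub_cancel]
    _ ≤ ‖u₀‖ + ‖u - u₀‖ := norm_add_le _ _
    _ ≤ Cb * ‖g‖ + Ca * (‖f‖ + ‖a‖ * (Cb * ‖g‖)) := by
      refine add_le_add hn (hw.trans ?_)
      gcongr
    _ = _ := by ring
  refine ⟨hu, ?_⟩
  have hp : ‖p‖ ≤ Cb * (‖f‖ + ‖a‖ * ‖u‖) :=
    norm_le_mul_norm_of_infsup hCb hinfsup (by positivity) p fun v => by
      have hf := (le_abs_self _).trans (f.le_opNorm v)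
      have ha := (neg_le_abs _).trans (a.le_opNorm₂ u v)
      linarith [h₁ v]
  calc ‖p‖ ≤ Cb * (‖f‖ + ‖a‖ * ‖u‖) := hp
    _ ≤ Cb * (‖f‖ + ‖a‖ * (Ca * ‖f‖ + Cb * (1 + ‖a‖ * Ca) * ‖g‖)) := by gcongr
    _ = _ := by ring

end MixedProblem


/-- **Babuška–Brezzi theorem.** Let `X`, `M` be real Hilbert spaces, `a`, `b` bounded
bilinear forms (represented as continuous bilinear maps), `V := {v | ∀ q, b v q = 0}`.
If `a` is coercive on `V` with constant `Ca` and `b` satisfies the inf-sup condition with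
constant `Cb`, then for every `f ∈ X'`, `g ∈ M'` the mixed variational problem has a unique
solution `(u, p)`, which moreover satisfies the stated norm estimates. -/
theorem babuska_brezzi
    {X M : Type*} [NormedAddCommGroup X] [InnerProductSpace ℝ X] [CompleteSpace X]
    [NormedAddCommGroup M] [InnerProductSpace ℝ M] [CompleteSpace M]
    (a : X →L[ℝ] X →L[ℝ] ℝ) (b : X →L[ℝ] M →L[ℝ] ℝ)
    (Ca Cb : ℝ) (hCa : 0 < Ca) (hCb : 0 < Cb)
    (hcoer : ∀ w : X, (∀ q : M, b w q = 0) → Ca⁻¹ * ‖w‖ ^ 2 ≤ a w w)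
    (hinfsup : ∀ q : M, q ≠ 0 → Cb⁻¹ ≤ ⨆ v : X, b v q / (‖v‖ * ‖q‖))
    (f : X →L[ℝ] ℝ) (g : M →L[ℝ] ℝ) :
    (∃! up : X × M, (∀ v : X, a up.1 v + b v up.2 = f v) ∧ (∀ q : M, b up.1 q = g q)) ∧
    (∀ u : X, ∀ p : M, (∀ v : X, a u v + b v p = f v) → (∀ q : M, b u q = g q) →
      ‖u‖ ≤ Ca * ‖f‖ + Cb * (1 + ‖a‖ * Ca) * ‖g‖ ∧
      ‖p‖ ≤ Cb * (1 + ‖a‖ * Ca) * ‖f‖ + ‖a‖ * Cb ^ 2 * (1 + ‖a‖ * Ca) * ‖g‖) := by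
  refine ⟨?_, fun u p h₁ h₂ => mixed_problem_norm_le hCa hCb hcoer hinfsup h₁ h₂⟩
  obtain ⟨u, p, h₁, h₂⟩ := mixed_problem_exists hCa hCb hcoer hinfsup f g
  refine ⟨(u, p), ⟨h₁, h₂⟩, ?_⟩
  rintro ⟨u', p'⟩ ⟨h₁', h₂'⟩
  obtain ⟨hu, hp⟩ := mixed_problem_norm_le hCa hCb hcoer hinfsup (f := 0) (g := 0)
    (u := u' - u) (p := p' - p)
    (fun v => by
      have e := h₁ v
      have e' := h₁' v
      simp only [map_sub, sub_apply, zero_apply] at e e' ⊢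
      linarith)
    (fun q => by
      have e' := h₂' q
      simp only at e'
      simp [h₂, e'])
  simp only [norm_zero, mul_zero, add_zero, norm_le_zero_iff, sub_eq_zero] at hu hp
  rw [hu, hp]
end

section
/- Let (X, ‖·‖_X) be a real Banach space and let (Y, ‖·‖_Y), (Z, ‖·‖_Z), (Υ, ‖·‖_Υ) be real normed spaces. Let P : X → Y, C : X → Z and T : X → Υ be continuous linear operators such that: (i) C is a compact operator; (ii) the map u ↦ ‖P(u)‖_Y + ‖C(u)‖_Z is a norm on X equivalent to ‖·‖_X (i.e., there exist constants c₁, c₂ > 0 with c₁‖u‖_X ≤ ‖P(u)‖_Y + ‖C(u)‖_Z ≤ c₂‖u‖_X for all u ∈ X); (iii) T(u) ≠ 0 whenever P(u) = 0 and u ≠ 0. Then there exist constants k₁, k₂ > 0 such that k₁‖u‖_X ≤ ‖P(u)‖_Y + ‖T(u)‖_Υ ≤ k₂‖u‖_X for all u ∈ X, i.e., u ↦ ‖P(u)‖_Y + ‖T(u)‖_Υ is a norm on X equivalent to ‖·‖_X. -/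
open Bornology

/-- If `‖P u‖ + ‖C u‖` controls `‖u‖` and `C` is compact, then every bounded sequence whose
image under `P` is Cauchy has a convergent subsequence. -/
theorem exists_tendsto_subseq_of_cauchySeq_image
    {X Y Z : Type*}
    [NormedAddCommGroup X] [NormedSpace ℝ X] [CompleteSpace X]
    [NormedAddCommGroup Y] [NormedSpace ℝ Y]
    [NormedAddCommGroup Z] [NormedSpace ℝ Z]
    {P : X →L[ℝ] Y} {C : X →L[ℝ] Z}
    (hC : ∀ s : Set X, IsBounded s → IsCompact (closure (C '' s)))
    {c : ℝ} (hc : 0 < c) (hlow : ∀ u : X, c * ‖u‖ ≤ ‖P u‖ + ‖C u‖)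
    {u : ℕ → X} (hu : IsBounded (Set.range u)) (hPu : CauchySeq fun n ↦ P (u n)) :
    ∃ x, ∃ φ : ℕ → ℕ, StrictMono φ ∧ Filter.Tendsto (u ∘ φ) Filter.atTop (nhds x) := by
  obtain ⟨z, -, φ, hφ, hz⟩ := (hC _ hu).tendsto_subseq (x := fun n ↦ C (u n))
    fun n ↦ subset_closure ⟨u n, ⟨n, rfl⟩, rfl⟩
  suffices CauchySeq (u ∘ φ) by
    obtain ⟨x, hx⟩ := cauchySeq_tendsto_of_complete this
    exact ⟨x, φ, hφ, hx⟩
  have hP := Metric.cauchySeq_iff.1 (hPu.comp_tendsto hφ.tendsto_atTop)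
  have hCu := Metric.cauchySeq_iff.1 hz.cauchySeq
  refine Metric.cauchySeq_iff.2 fun ε hε ↦ ?_
  obtain ⟨N, hN⟩ := hP (c * ε / 2) (by positivity)
  obtain ⟨M, hM⟩ := hCu (c * ε / 2) (by positivity)
  refine ⟨max N M, fun m hm n hn ↦ ?_⟩
  have h₁ := hN m (le_of_max_le_left hm) n (le_of_max_le_left hn)
  have h₂ := hM m (le_of_max_le_right hm) n (le_of_max_le_right hn)
  have h₃ := hlow (u (φ m) - u (φ n))
  simp only [Function.comp_apply, dist_eq_norm, map_sub] at h₁ h₂ h₃ ⊢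
  exact lt_of_mul_lt_mul_left (by linarith) hc.le

/-- **Tartar's lemma on equivalent norms.** If `P`, `C`, `T` are continuous linear operators
from a Banach space `X` into normed spaces, `C` is compact, `u ↦ ‖P u‖ + ‖C u‖` is a norm
equivalent to `‖·‖_X`, and `T u ≠ 0` whenever `P u = 0` and `u ≠ 0`, then
`u ↦ ‖P u‖ + ‖T u‖` is a norm on `X` equivalent to `‖·‖_X`. -/
theorem tartar_equivalent_norms
    {X Y Z Υ : Type*}
    [NormedAddCommGroup X] [NormedSpace ℝ X] [CompleteSpace X]
    [NormedAddCommGroup Y] [NormedSpace ℝ Y]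
    [NormedAddCommGroup Z] [NormedSpace ℝ Z]
    [NormedAddCommGroup Υ] [NormedSpace ℝ Υ]
    (P : X →L[ℝ] Y) (C : X →L[ℝ] Z) (T : X →L[ℝ] Υ)
    (hC : ∀ s : Set X, IsBounded s → IsCompact (closure (C '' s)))
    (c₁ c₂ : ℝ) (hc₁ : 0 < c₁) (hc₂ : 0 < c₂)
    (hlow : ∀ u : X, c₁ * ‖u‖ ≤ ‖P u‖ + ‖C u‖)
    (hup : ∀ u : X, ‖P u‖ + ‖C u‖ ≤ c₂ * ‖u‖)
    (hT : ∀ u : X, P u = 0 → u ≠ 0 → T u ≠ 0) :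
    ∃ k₁ k₂ : ℝ, 0 < k₁ ∧ 0 < k₂ ∧
      ∀ u : X, k₁ * ‖u‖ ≤ ‖P u‖ + ‖T u‖ ∧ ‖P u‖ + ‖T u‖ ≤ k₂ * ‖u‖ := by
  obtain ⟨k, hk, hlowT⟩ : ∃ k : ℝ, 0 < k ∧ ∀ u : X, k * ‖u‖ ≤ ‖P u‖ + ‖T u‖ := by
    by_contra! h
    have h' : ∀ n : ℕ, ∃ v : X, ‖v‖ = 1 ∧ ‖P v‖ + ‖T v‖ ≤ 1 / ((n : ℝ) + 1) := fun n ↦ by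
      obtain ⟨u, hu⟩ := h (1 / ((n : ℝ) + 1)) Nat.one_div_pos_of_nat
      have hu₀ : u ≠ 0 := by
        rintro rfl
        simp at hu
      have hpos : 0 < ‖u‖ := norm_pos_iff.2 hu₀
      refine ⟨‖u‖⁻¹ • u, by simp [norm_smul, hpos.ne'], ?_⟩
      rw [map_smul, map_smul, norm_smul, norm_smul, ← mul_add, norm_inv, norm_norm,
        inv_mul_le_iff₀ hpos, mul_comm]
      exact hu.le
    choose v hv hPT using h'
    have hP : Filter.Tendsto (fun n ↦ P (v n)) Filter.atTop (nhds 0) :=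
      squeeze_zero_norm (fun n ↦ (le_add_of_nonneg_right (norm_nonneg _)).trans (hPT n))
        tendsto_one_div_add_atTop_nhds_zero_nat
    have hTv : Filter.Tendsto (fun n ↦ T (v n)) Filter.atTop (nhds 0) :=
      squeeze_zero_norm (fun n ↦ (le_add_of_nonneg_left (norm_nonneg _)).trans (hPT n))
        tendsto_one_div_add_atTop_nhds_zero_nat
    have hb : IsBounded (Set.range v) :=
      isBounded_iff_forall_norm_le.2 ⟨1, by rintro _ ⟨n, rfl⟩; exact (hv n).le⟩
    obtain ⟨x, φ, hφ, hx⟩ :=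
      exists_tendsto_subseq_of_cauchySeq_image hC hc₁ hlow hb hP.cauchySeq
    have hx₁ : ‖x‖ = 1 :=
      tendsto_nhds_unique hx.norm (by simp [hv])
    have hPx : P x = 0 :=
      tendsto_nhds_unique ((P.continuous.tendsto x).comp hx) (hP.comp hφ.tendsto_atTop)
    have hTx : T x = 0 :=
      tendsto_nhds_unique ((T.continuous.tendsto x).comp hx) (hTv.comp hφ.tendsto_atTop)
    exact hT x hPx (norm_ne_zero_iff.1 (by simp [hx₁])) hTx
  refine ⟨k, ‖P‖ + ‖T‖ + 1, hk, by positivity, fun u ↦ ⟨hlowT u, ?_⟩⟩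
  linarith [P.le_opNorm u, T.le_opNorm u, norm_nonneg u]
end

section
/- Let X be a real Banach space and let T : X → X be a continuous mapping that is compact, i.e., the image under T of every bounded subset of X has compact closure in X. If the set {x ∈ X : x = χ·T(x) for some χ ∈ [0,1]} is bounded, then T has a fixed point, i.e., there exists x ∈ X with T(x) = x. -/
open Bornology

open Set Metric MeasureTheory Filter Topology Module
open scoped NNReal

section NoRetraction

theorem exists_polynomial_eval_eq_det_one_add_smul {E : Type*} [NormedAddCommGroup E]
    [NormedSpace ℝ E] [FiniteDimensional ℝ E] (A : E →L[ℝ] E) :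
    ∃ p : Polynomial ℝ, p.natDegree ≤ finrank ℝ E ∧ ∀ t : ℝ, p.eval t = (1 + t • A).det := by
  let b := finBasis ℝ E
  let M := LinearMap.toMatrix b b (A : E →ₗ[ℝ] E)
  refine ⟨((Polynomial.X : Polynomial ℝ) • M.map Polynomial.C +
    (1 : Matrix _ _ ℝ).map Polynomial.C).det, ?_, fun t => ?_⟩
  · simpa using Polynomial.natDegree_det_X_add_C_le M 1
  · rw [ContinuousLinearMap.det, ← LinearMap.det_toMatrix b, ← Polynomial.coe_evalRingHom,
      RingHom.map_det]
    congr 1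
    have : ((1 + t • A : E →L[ℝ] E) : E →ₗ[ℝ] E) = 1 + t • (A : E →ₗ[ℝ] E) := rfl
    rw [this, map_add (LinearMap.toMatrix b b), map_smul (LinearMap.toMatrix b b),
      LinearMap.toMatrix_one]
    ext i j
    simp [M, add_comm, mul_comm t, Matrix.one_apply, apply_ite]

variable {E : Type*} [NormedAddCommGroup E] [InnerProductSpace ℝ E] [FiniteDimensional ℝ E]

theorem det_fderiv_eq_zero_of_norm_eq {r : E → E} {R : ℝ} (hR : 0 < R)
    (hr : Differentiable ℝ r) (hrR : ∀ x, ‖r x‖ = R) (x : E) : (fderiv ℝ r x).det = 0 := by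
  by_contra h
  have hs : Function.Surjective (fderiv ℝ r x) :=
    (LinearMap.equivOfDetNeZero (fderiv ℝ r x : E →ₗ[ℝ] E) h).surjective
  obtain ⟨v, hv⟩ := hs (r x)
  have h1 := (hr x).hasFDerivAt.norm_sq
  have h2 : (fun y => ‖r y‖ ^ 2) = fun _ => R ^ 2 := by simp [hrR]
  rw [h2] at h1
  have h3 := congrArg (fun L => L v) (h1.unique (hasFDerivAt_const _ _))
  simp [hv, hrR, hR.ne'] at h3

theorem image_ball_eq_ball {f : E → E} {R : ℝ} {c : ℝ≥0} (hR : 0 < R)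
    (hf : ContinuousOn f (closedBall 0 R))
    (happ : ApproximatesLinearOn f (ContinuousLinearMap.id ℝ E) (ball 0 R) c) (hc : c < 1)
    (hball : MapsTo f (ball 0 R) (ball 0 R)) (hsphere : ∀ x ∈ sphere (0 : E) R, f x = x) :
    f '' ball 0 R = ball 0 R := by
  have hopen : IsOpen (f '' ball 0 R) := by
    let e : (ContinuousLinearMap.id ℝ E).NonlinearRightInverse :=
      ⟨id, 1, by simp, by simp⟩
    exact happ.open_image e isOpen_ball (Or.inr (by simpa [e] using hc))
  refine hball.image_subset.antisymm ?_
  have hcl : IsClosed (f '' closedBall 0 R) :=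
    ((isCompact_closedBall 0 R).image_of_continuousOn hf).isClosed
  have hfr : f '' closedBall 0 R ⊆ f '' ball 0 R ∪ sphere 0 R := by
    rw [← ball_union_sphere, image_union]
    refine union_subset_union_right _ ?_
    rintro _ ⟨x, hx, rfl⟩
    rwa [hsphere x hx]
  refine (convex_ball (0 : E) R).isPreconnected.subset_of_closure_inter_subset hopen
    ⟨f 0, hball (mem_ball_self hR), mem_image_of_mem f (mem_ball_self hR)⟩ ?_
  rintro y ⟨hy, hyb⟩
  rcases hfr (closure_minimal (image_mono ball_subset_closedBall) hcl hy) with h | h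
  · exact h
  · rw [mem_sphere] at h
    rw [mem_ball] at hyb
    linarith

theorem no_smooth_retraction {r : E → E} {R : ℝ} (hR : 0 < R) (hr : ContDiff ℝ 1 r)
    (hrR : ∀ x, ‖r x‖ = R) (hsphere : ∀ x ∈ sphere (0 : E) R, r x = x) : False := by
  borelize E
  let μ : Measure E := Measure.addHaar
  let g : E → E := fun x => r x - x
  have hg : ContDiff ℝ 1 g := hr.sub contDiff_id
  have hgd : Differentiable ℝ g := hg.differentiable one_ne_zero
  have hDc : Continuous (fderiv ℝ g) := hg.continuous_fderiv one_ne_zero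
  have hf : ∀ (t : ℝ) (x : E),
      HasFDerivAt (fun x => x + t • g x) (1 + t • fderiv ℝ g x) x := fun t x =>
    (hasFDerivAt_id x).add ((hgd x).hasFDerivAt.fun_const_smul t)
  have hdet0 : ∀ x, (1 + (1 : ℝ) • fderiv ℝ g x).det = 0 := fun x => by
    rw [← (hf 1 x).fderiv]
    simpa [g] using det_fderiv_eq_zero_of_norm_eq hR (hr.differentiable one_ne_zero) hrR x
  have hdetc : ∀ t : ℝ, Continuous fun x => (1 + t • fderiv ℝ g x).det := fun t =>
    ContinuousLinearMap.continuous_det.comp (continuous_const.add (hDc.const_smul t))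
  have hint : ∀ t : ℝ, IntegrableOn (fun x => (1 + t • fderiv ℝ g x).det) (ball 0 R) μ := fun t =>
    ((hdetc t).continuousOn.integrableOn_compact (isCompact_closedBall 0 R)).mono_set
      ball_subset_closedBall
  obtain ⟨K, hK⟩ := hg.contDiffOn.exists_lipschitzOnWith one_ne_zero (convex_closedBall (0 : E) R)
    (isCompact_closedBall 0 R)
  have hpos : ∀ᶠ t : ℝ in 𝓝 0, ∀ x ∈ closedBall (0 : E) R, 0 < (1 + t • fderiv ℝ g x).det := by
    refine (isCompact_closedBall (0 : E) R).eventually_forall_of_forall_eventually fun x _ => ?_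
    have hc : Continuous fun z : ℝ × E => (1 + z.1 • fderiv ℝ g z.2).det :=
      ContinuousLinearMap.continuous_det.comp
        (continuous_const.add (continuous_fst.smul (hDc.comp continuous_snd)))
    refine hc.continuousAt.eventually (lt_mem_nhds ?_)
    simp [ContinuousLinearMap.det]
  have hKt : ∀ᶠ t : ℝ in 𝓝 0, ‖t‖₊ * K < 1 := by
    have hc : Continuous fun t : ℝ => ‖t‖₊ * K := by fun_prop
    exact hc.continuousAt.eventually (gt_mem_nhds (by simp))
  have hvol : ∀ᶠ t : ℝ in 𝓝[>] 0,
      ∫ x in ball 0 R, (1 + t • fderiv ℝ g x).det ∂μ = μ.real (ball 0 R) := by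
    filter_upwards [nhdsWithin_le_nhds hpos, nhdsWithin_le_nhds hKt, self_mem_nhdsWithin,
      nhdsWithin_le_nhds (gt_mem_nhds (zero_lt_one' ℝ))] with t hpos hKt (ht0 : 0 < t) ht1
    have happ : ApproximatesLinearOn (fun x => x + t • g x) (ContinuousLinearMap.id ℝ E)
        (ball 0 R) (‖t‖₊ * K) := by
      refine LipschitzOnWith.approximatesLinearOn ?_
      have := (lipschitzWith_smul t).comp_lipschitzOnWith (hK.mono ball_subset_closedBall)
      have hsub : (fun x => x + t • g x) - ⇑(ContinuousLinearMap.id ℝ E) =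
          (fun x => t • x) ∘ g := by
        ext x
        simp
      rwa [hsub]
    have himage : (fun x => x + t • g x) '' ball 0 R = ball 0 R := by
      refine image_ball_eq_ball hR (by have := hg.continuous; fun_prop) happ hKt ?_ ?_
      · intro x hx
        rw [mem_ball_zero_iff] at hx ⊢
        calc ‖x + t • g x‖ = ‖(1 - t) • x + t • r x‖ := by
              congr 1; simp only [g, smul_sub, sub_smul, one_smul]; abel
          _ ≤ ‖(1 - t) • x‖ + ‖t • r x‖ := norm_add_le _ _
          _ = (1 - t) * ‖x‖ + t * R := by
              rw [norm_smul, norm_smul, hrR, Real.norm_of_nonneg ht0.le,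
                Real.norm_of_nonneg (sub_nonneg.2 ht1.le)]
          _ < R := by nlinarith
      · intro x hx
        simp [g, hsphere x hx]
    have hinj : InjOn (fun x => x + t • g x) (ball 0 R) := by
      refine ApproximatesLinearOn.injOn (f' := ContinuousLinearEquiv.refl ℝ E) happ ?_
      rcases subsingleton_or_nontrivial E with h | h
      · exact Or.inl h
      · right
        have : ‖((ContinuousLinearEquiv.refl ℝ E).symm : E →L[ℝ] E)‖₊ = 1 :=
          NNReal.eq ContinuousLinearMap.norm_id
        rwa [this, inv_one]
    have key := integral_image_eq_integral_abs_det_fderiv_smul μ measurableSet_ball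
      (fun x _ => (hf t x).hasFDerivWithinAt) hinj (fun _ => (1 : ℝ))
    rw [himage] at key
    simp only [smul_eq_mul, mul_one, integral_const, measureReal_restrict_apply_univ] at key
    rw [key]
    refine setIntegral_congr_fun measurableSet_ball fun x hx => ?_
    exact (abs_of_pos (hpos x (ball_subset_closedBall hx))).symm
  obtain ⟨ε, hε0, hε⟩ := mem_nhdsGT_iff_exists_Ioc_subset.1 hvol
  have hε0 : (0 : ℝ) < ε := hε0
  let s := Finset.range (finrank ℝ E + 1)
  let v : ℕ → ℝ := fun i => ε / (i + 1)
  have hv : InjOn v s := fun i _ j _ hij => by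
    have hij : ε / (i + 1) = ε / (j + 1) := hij
    field_simp at hij
    exact_mod_cast (by linarith : (i : ℝ) = j)
  have hvε : ∀ i, v i ∈ Ioc 0 ε := fun i =>
    ⟨by positivity, div_le_self hε0.le (by linarith [i.cast_nonneg (α := ℝ)])⟩
  have hlag : ∀ p : Polynomial ℝ, p.natDegree ≤ finrank ℝ E →
      p.eval 1 = ∑ i ∈ s, p.eval (v i) * (Lagrange.basis s v i).eval 1 := fun p hp => by
    conv_lhs => rw [Lagrange.eq_interpolate (f := p) hv (by
      refine lt_of_le_of_lt Polynomial.degree_le_natDegree ?_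
      simp only [s, Finset.card_range]
      exact_mod_cast Nat.lt_succ_of_le hp)]
    simp [Lagrange.interpolate_apply, Polynomial.eval_finsetSum]
  have hdet : ∀ x, (0 : ℝ) =
      ∑ i ∈ s, (1 + v i • fderiv ℝ g x).det * (Lagrange.basis s v i).eval 1 := fun x => by
    obtain ⟨p, hp, hpe⟩ := exists_polynomial_eval_eq_det_one_add_smul (fderiv ℝ g x)
    simpa only [hpe, hdet0] using hlag p hp
  have hsum : ∑ i ∈ s, (Lagrange.basis s v i).eval 1 = 1 := by
    simpa using (hlag 1 (by simp)).symm
  have hzero : (0 : ℝ) = μ.real (ball 0 R) := calc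
    (0 : ℝ) = ∫ x in ball 0 R,
        ∑ i ∈ s, (1 + v i • fderiv ℝ g x).det * (Lagrange.basis s v i).eval 1 ∂μ := by
      simp only [← hdet, integral_zero]
    _ = ∑ i ∈ s, μ.real (ball 0 R) * (Lagrange.basis s v i).eval 1 := by
      rw [integral_finsetSum _ fun i _ => (hint (v i)).mul_const _]
      refine Finset.sum_congr rfl fun i _ => ?_
      rw [integral_mul_const]
      congr 1
      exact hε (hvε i)
    _ = μ.real (ball 0 R) := by rw [← Finset.mul_sum, hsum, mul_one]
  have : 0 < μ.real (ball 0 R) :=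
    ENNReal.toReal_pos (measure_ball_pos μ 0 hR).ne' measure_ball_lt_top.ne
  linarith

end NoRetraction

section Brouwer

theorem ContDiff.exists_fixedPoint_of_norm_le {E : Type*} [NormedAddCommGroup E]
    [InnerProductSpace ℝ E] [FiniteDimensional ℝ E] {f : E → E} (hf : ContDiff ℝ 1 f) {M : ℝ}
    (hM : ∀ x, ‖f x‖ ≤ M) : ∃ x, f x = x := by
  by_contra! hne
  have hM0 : 0 ≤ M := (norm_nonneg _).trans (hM 0)
  let φ : ContDiffBump (0 : E) := ⟨M + 1, M + 2, by linarith, by linarith⟩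
  let F : E → E := fun x => x - φ x • f x
  have hF : ContDiff ℝ 1 F := contDiff_id.sub (φ.contDiff.smul hf)
  have hF0 : ∀ x, F x ≠ 0 := fun x hx => by
    have hx : x = φ x • f x := sub_eq_zero.1 hx
    have hxM : ‖x‖ ≤ M := calc
      ‖x‖ = φ x * ‖f x‖ := by
        conv_lhs => rw [hx, norm_smul, Real.norm_of_nonneg φ.nonneg]
      _ ≤ 1 * M := mul_le_mul φ.le_one (hM x) (norm_nonneg _) zero_le_one
      _ = M := one_mul M
    have h1 : φ x = 1 := φ.one_of_mem_closedBall (by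
      rw [mem_closedBall_zero_iff]
      exact hxM.trans (by simp [φ]))
    rw [h1, one_smul] at hx
    exact hne x hx.symm
  have hR : 0 < M + 2 := by linarith
  refine no_smooth_retraction (r := fun x => ((M + 2) / ‖F x‖) • F x) hR
    ((contDiff_const.div (hF.norm ℝ hF0) fun x => norm_ne_zero_iff.2 (hF0 x)).smul hF) ?_ ?_
  · intro x
    have := norm_pos_iff.2 (hF0 x)
    rw [norm_smul, Real.norm_of_nonneg (by positivity)]
    field_simp
  · intro x hx
    rw [mem_sphere_zero_iff_norm] at hx
    have h0 : φ x = 0 := φ.zero_of_le_dist (by simp [φ, hx])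
    simp [F, h0, hx, hR.ne']

theorem Continuous.exists_fixedPoint_of_norm_le {E : Type*} [NormedAddCommGroup E]
    [InnerProductSpace ℝ E] [FiniteDimensional ℝ E] {f : E → E} (hf : Continuous f) {M : ℝ}
    (hM : ∀ x, ‖f x‖ ≤ M) : ∃ x, f x = x := by
  by_contra! hne
  obtain ⟨x₀, -, hx₀⟩ := (isCompact_closedBall (0 : E) (M + 1)).exists_isMinOn
    ⟨0, by simpa using by linarith [(norm_nonneg _).trans (hM 0)]⟩
    (f := fun x => ‖f x - x‖) (by fun_prop)
  let δ := min ‖f x₀ - x₀‖ 1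
  have hδ : 0 < δ := lt_min (norm_pos_iff.2 (sub_ne_zero.2 (hne x₀))) one_pos
  have hδle : ∀ x, δ ≤ ‖f x - x‖ := fun x => by
    by_cases hx : x ∈ closedBall 0 (M + 1)
    · exact (min_le_left _ _).trans (hx₀ hx)
    · rw [mem_closedBall_zero_iff, not_le] at hx
      have := norm_sub_norm_le x (f x)
      rw [norm_sub_rev] at this
      linarith [min_le_right ‖f x₀ - x₀‖ 1, hM x]
  obtain ⟨h, hh, hclose, -⟩ := hf.exists_contDiff_approx 1 continuous_const fun _ => hδ
  obtain ⟨x, hx⟩ := ContDiff.exists_fixedPoint_of_norm_le hh (M := M + δ) fun x => by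
    have h1 := hclose x
    rw [dist_eq_norm] at h1
    linarith [norm_le_norm_add_norm_sub' (h x) (f x), hM x]
  have h1 := hclose x
  rw [hx, dist_comm, dist_eq_norm] at h1
  exact (hδle x).not_gt h1

/-- A form of **Brouwer's fixed point theorem**: a continuous self-map of a finite-dimensional
space with bounded range has a fixed point. -/
theorem Continuous.exists_fixedPoint_of_isBounded_range {V : Type*} [NormedAddCommGroup V]
    [NormedSpace ℝ V] [FiniteDimensional ℝ V] {f : V → V} (hf : Continuous f)
    (hb : IsBounded (range f)) : ∃ x, f x = x := by
  let e := toEuclidean (E := V)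
  obtain ⟨M, hM⟩ := (e.lipschitz.isBounded_image hb).exists_norm_le
  obtain ⟨x, hx⟩ := Continuous.exists_fixedPoint_of_norm_le (f := fun x => e (f (e.symm x)))
    (by fun_prop) (M := M) fun x => hM _ (mem_image_of_mem e (mem_range_self _))
  exact ⟨e.symm x, e.injective (by simpa using hx)⟩

end Brouwer

section Schauder

variable {X : Type*} [NormedAddCommGroup X] [NormedSpace ℝ X]

/-- The Schauder projection onto the convex hull of a finite `ε`-net. -/
theorem IsCompact.exists_finset_continuousOn_norm_sub_le {K : Set X} (hK : IsCompact K) {ε : ℝ}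
    (hε : 0 < ε) : ∃ (t : Finset X) (P : X → X), ContinuousOn P K ∧
      ∀ y ∈ K, P y ∈ convexHull ℝ (t : Set X) ∧ ‖P y - y‖ ≤ ε := by
  classical
  obtain ⟨t, -, ht, hcover⟩ := hK.finite_cover_balls hε
  lift t to Finset X using ht
  let w : X → X → ℝ := fun y a => max (ε - ‖a - y‖) 0
  have hw : ∀ a, Continuous fun y => w y a := fun a => by fun_prop
  have hw0 : ∀ y a, 0 ≤ w y a := fun y a => le_max_right _ _
  have hpos : ∀ y ∈ K, 0 < ∑ a ∈ t, w y a := fun y hy => by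
    obtain ⟨a, ha, hya⟩ := mem_iUnion₂.1 (hcover hy)
    refine Finset.sum_pos' (fun a _ => hw0 y a) ⟨a, ha, lt_max_of_lt_left ?_⟩
    rw [mem_ball, dist_eq_norm, norm_sub_rev] at hya
    linarith
  refine ⟨t, fun y => t.centerMass (w y) id, ?_, fun y hy => ⟨?_, ?_⟩⟩
  · refine ContinuousOn.smul (ContinuousOn.inv₀ ?_ fun y hy => (hpos y hy).ne') ?_ <;> fun_prop
  · exact t.centerMass_id_mem_convexHull (fun a _ => hw0 y a) (hpos y hy)
  · beta_reduce
    rw [← mem_closedBall_iff_norm, ← Finset.centerMass_filter_ne_zero]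
    refine (convex_closedBall y ε).centerMass_mem (fun a _ => hw0 y a) ?_ fun a ha => ?_
    · rw [Finset.sum_filter_ne_zero]
      exact hpos y hy
    · rw [id, mem_closedBall_iff_norm]
      by_contra! h
      exact (Finset.mem_filter.1 ha).2 (max_eq_right (by linarith))

theorem exists_norm_sub_le_of_isCompact {S : X → X} (hS : Continuous S) {K : Set X}
    (hK : IsCompact K) (hSK : ∀ x, S x ∈ K) {ε : ℝ} (hε : 0 < ε) : ∃ x, ‖S x - x‖ ≤ ε := by
  obtain ⟨t, P, hP, hPK⟩ := hK.exists_finset_continuousOn_norm_sub_le hε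
  let V := Submodule.span ℝ (t : Set X)
  have : FiniteDimensional ℝ V := FiniteDimensional.span_finset ℝ t
  have hV : convexHull ℝ (t : Set X) ⊆ V :=
    convexHull_min Submodule.subset_span V.convex
  have hc : Continuous fun x : V => P (S x) :=
    hP.comp_continuous (hS.comp continuous_subtype_val) fun x => hSK x
  obtain ⟨x, hx⟩ := Continuous.exists_fixedPoint_of_isBounded_range
    (f := fun x : V => (⟨P (S x), hV (hPK _ (hSK x)).1⟩ : V)) (hc.subtype_mk _) (by
      obtain ⟨C, hC⟩ := (isBounded_convexHull.2 t.finite_toSet.isBounded).exists_norm_le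
      refine isBounded_iff_forall_norm_le.2 ⟨C, ?_⟩
      rintro _ ⟨x, rfl⟩
      exact hC _ (hPK _ (hSK x)).1)
  refine ⟨x, ?_⟩
  have hx : P (S x) = x := congrArg Subtype.val hx
  have := (hPK _ (hSK x)).2
  rwa [hx, norm_sub_rev] at this

/-- A form of **Schauder's fixed point theorem**: a continuous map with range in a compact set
has a fixed point. -/
theorem Continuous.exists_fixedPoint_of_isCompact {S : X → X} (hS : Continuous S) {K : Set X}
    (hK : IsCompact K) (hSK : ∀ x, S x ∈ K) : ∃ x, S x = x := by
  choose x hx using fun n : ℕ =>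
    exists_norm_sub_le_of_isCompact hS hK hSK (Nat.one_div_pos_of_nat (α := ℝ) (n := n))
  obtain ⟨y, -, k, hk, hy⟩ := hK.tendsto_subseq fun n => hSK (x n)
  have hsub : Tendsto (fun n => S (x n) - x n) atTop (𝓝 0) :=
    squeeze_zero_norm hx tendsto_one_div_add_atTop_nhds_zero_nat
  have hxy : Tendsto (x ∘ k) atTop (𝓝 y) := by
    simpa [Function.comp_def] using hy.sub (hsub.comp hk.tendsto_atTop)
  exact ⟨y, tendsto_nhds_unique ((hS.tendsto y).comp hxy) hy⟩

end Schauder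

/-- **Leray–Schauder fixed point theorem** (Gilbarg–Trudinger, Theorem 11.3).
Let `X` be a real Banach space and `T : X → X` a continuous, compact mapping
(the image of every bounded set has compact closure). If the set
`{x ∈ X : x = χ • T x for some χ ∈ [0,1]}` is bounded, then `T` has a fixed point. -/
theorem leray_schauder_fixed_point
    {X : Type*} [NormedAddCommGroup X] [NormedSpace ℝ X] [CompleteSpace X]
    (T : X → X) (hTcont : Continuous T)
    (hTcomp : ∀ s : Set X, IsBounded s → IsCompact (closure (T '' s)))
    (hbdd : IsBounded {x : X | ∃ χ ∈ Set.Icc (0 : ℝ) 1, x = χ • T x}) :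
    ∃ x : X, T x = x := by
  obtain ⟨M, hM0, hM⟩ := hbdd.exists_pos_norm_lt
  let ρ : X → X := fun x => (M / max M ‖x‖) • x
  have hmax : ∀ x : X, 0 < max M ‖x‖ := fun x => lt_max_of_lt_left hM0
  have hρ : Continuous ρ :=
    (continuous_const.div (by fun_prop) fun x => (hmax x).ne').smul continuous_id
  have hρM : ∀ x, ρ x ∈ closedBall 0 M := fun x => by
    rw [mem_closedBall_zero_iff, norm_smul, Real.norm_of_nonneg (div_pos hM0 (hmax x)).le,
      div_mul_eq_mul_div, div_le_iff₀ (hmax x)]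
    exact mul_le_mul_of_nonneg_left (le_max_right _ _) hM0.le
  obtain ⟨x, hx⟩ := (hTcont.comp hρ).exists_fixedPoint_of_isCompact
    (hTcomp _ isBounded_closedBall) fun x => subset_closure (mem_image_of_mem T (hρM x))
  have hx : T (ρ x) = x := hx
  rcases le_or_gt ‖x‖ M with h | h
  · have : ρ x = x := by simp [ρ, max_eq_left h, hM0.ne']
    exact ⟨x, by rwa [this] at hx⟩
  · have h0 : 0 < ‖x‖ := hM0.trans h
    have hlt := hM (ρ x) ⟨M / max M ‖x‖, ⟨(div_pos hM0 (hmax x)).le,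
      div_le_one_of_le₀ (le_max_left _ _) (hmax x).le⟩, by rw [hx]⟩
    have : ‖ρ x‖ = M := by
      simp only [ρ, max_eq_right h.le]
      rw [norm_smul, Real.norm_of_nonneg (by positivity)]
      field_simp
    exact absurd this hlt.ne
end

section
/- Let n ≥ 3 and let a_{ij}^{αβ} (1 ≤ i,j,α,β ≤ n) be real numbers satisfying the symmetry conditions and the symmetric ellipticity condition with some constant c_𝔸 > 0. Then for every ξ = (ξ₁,…,ξₙ) ∈ ℝⁿ with ξ ≠ 0, the complex (n+1)×(n+1) matrix σ(ξ) with entries σ(ξ)_{ℓj} = ξ_α a_{ℓj}^{αβ} ξ_β for 1 ≤ ℓ,j ≤ n, σ(ξ)_{ℓ,n+1} = −i ξ_ℓ and σ(ξ)_{n+1,j} = −i ξ_j for 1 ≤ ℓ,j ≤ n, and σ(ξ)_{n+1,n+1} = 0 (where i is the imaginary unit) is invertible. Equivalently, the real (n+1)×(n+1) matrix obtained by replacing the entries −i ξ_ℓ and −i ξ_j by −ξ_ℓ and −ξ_j is invertible. In other words, the anisotropic Stokes system with such a coefficient tensor is elliptic in the sense of Agmon–Douglis–Nirenberg. -/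
open scoped BigOperators

/-- The rank-one symmetrization `v ⊗ ξ + ξ ⊗ v` has the value `4 (v ⊗ ξ) : a : (v ⊗ ξ)` in the
quadratic form of a tensor that is symmetric within each index pair. -/
theorem sum_mul_symmetrized {ι : Type*} [Fintype ι] (a : ι → ι → ι → ι → ℝ)
    (hsym : ∀ i j α β, a i j α β = a α j i β ∧ a i j α β = a i β α j) (v ξ : ι → ℝ) :
    ∑ i, ∑ j, ∑ α, ∑ β, a i j α β * (v i * ξ α + v α * ξ i) * (v j * ξ β + v β * ξ j) =
      4 * ∑ i, v i * ∑ j, (∑ α, ∑ β, ξ α * a i j α β * ξ β) * v j := by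
  have swap_left (f : ι → ι → ι → ι → ℝ) :
      ∑ i, ∑ j, ∑ α, ∑ β, f i j α β = ∑ i, ∑ j, ∑ α, ∑ β, f α j i β := by
    rw [Finset.sum_comm]
    conv_rhs => rw [Finset.sum_comm]
    exact Finset.sum_congr rfl fun j _ => Finset.sum_comm
  have swap_right (f : ι → ι → ι → ι → ℝ) :
      ∑ i, ∑ j, ∑ α, ∑ β, f i j α β = ∑ i, ∑ j, ∑ α, ∑ β, f i β α j := by
    refine Finset.sum_congr rfl fun i _ => ?_
    rw [Finset.sum_comm]
    conv_rhs => rw [Finset.sum_comm]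
    exact Finset.sum_congr rfl fun α _ => Finset.sum_comm
  have left : ∑ i, ∑ j, ∑ α, ∑ β,
        a i j α β * (v i * ξ α + v α * ξ i) * (v j * ξ β + v β * ξ j) =
      2 * ∑ i, ∑ j, ∑ α, ∑ β, a i j α β * (v i * ξ α) * (v j * ξ β + v β * ξ j) := by
    simp only [mul_add, add_mul, Finset.sum_add_distrib, two_mul]
    rw [swap_left fun i j α β => a i j α β * (v α * ξ i) * (v j * ξ β),
      swap_left fun i j α β => a i j α β * (v α * ξ i) * (v β * ξ j)]
    simp only [← (hsym _ _ _ _).1]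
  have right : ∑ i, ∑ j, ∑ α, ∑ β, a i j α β * (v i * ξ α) * (v j * ξ β + v β * ξ j) =
      2 * ∑ i, ∑ j, ∑ α, ∑ β, a i j α β * (v i * ξ α) * (v j * ξ β) := by
    simp only [mul_add, Finset.sum_add_distrib, two_mul]
    rw [swap_right fun i j α β => a i j α β * (v i * ξ α) * (v β * ξ j)]
    simp only [← (hsym _ _ _ _).2]
  rw [left, right, ← mul_assoc]
  norm_num only
  congr 1
  simp only [Finset.mul_sum, Finset.sum_mul]
  refine Finset.sum_congr rfl fun i _ => Finset.sum_congr rfl fun j _ =>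
    Finset.sum_congr rfl fun α _ => Finset.sum_congr rfl fun β _ => ?_
  ring

/-- Symmetric ellipticity gives definiteness of the symbol on the hyperplane orthogonal to `ξ`. -/
theorem eq_zero_of_symbol_form_eq_zero {ι : Type*} [Fintype ι] (a : ι → ι → ι → ι → ℝ)
    (cA : ℝ) (hcA : 0 < cA)
    (hsym : ∀ i j α β, a i j α β = a α j i β ∧ a i j α β = a i β α j)
    (hell : ∀ ξ : Matrix ι ι ℝ, ξ.IsSymm → (∑ i, ξ i i) = 0 →
      cA⁻¹ * (∑ i, ∑ α, ξ i α ^ 2) ≤ ∑ i, ∑ j, ∑ α, ∑ β, a i j α β * ξ i α * ξ j β)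
    {ξ : ι → ℝ} (hξ : ξ ≠ 0) {v : ι → ℝ} (hv : ∑ i, v i * ξ i = 0)
    (hform : ∑ i, v i * ∑ j, (∑ α, ∑ β, ξ α * a i j α β * ξ β) * v j = 0) : v = 0 := by
  have hle := hell (Matrix.of fun i α => v i * ξ α + v α * ξ i)
    (by ext i j; simp only [Matrix.transpose_apply, Matrix.of_apply]; ring)
    (by simp only [Matrix.of_apply, Finset.sum_add_distrib, hv, add_zero])
  simp only [Matrix.of_apply] at hle
  rw [sum_mul_symmetrized a hsym, hform, mul_zero] at hle
  have hsum : ∑ i, ∑ α, (v i * ξ α + v α * ξ i) ^ 2 = 0 :=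
    le_antisymm (nonpos_of_mul_nonpos_right hle (inv_pos.2 hcA)) (by positivity)
  have hzero (i α : ι) : v i * ξ α + v α * ξ i = 0 := by
    rw [Finset.sum_eq_zero_iff_of_nonneg fun i _ => by positivity] at hsum
    have hi := hsum i (Finset.mem_univ i)
    rw [Finset.sum_eq_zero_iff_of_nonneg fun α _ => by positivity] at hi
    exact (pow_eq_zero_iff two_ne_zero).1 (hi α (Finset.mem_univ α))
  obtain ⟨k, hk⟩ := Function.ne_iff.1 hξ
  have hvk : v k = 0 := by
    have : v k * ξ k = 0 := by linarith [hzero k k]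
    exact (mul_eq_zero.1 this).resolve_right hk
  funext i
  have := hzero i k
  rw [hvk, zero_mul, add_zero] at this
  exact (mul_eq_zero.1 this).resolve_right hk

/-- **Agmon–Douglis–Nirenberg ellipticity of the anisotropic Stokes system.**
If the coefficient tensor `a` satisfies the symmetry conditions and the symmetric
ellipticity condition with constant `cA > 0`, then for every `ξ ≠ 0` the principal symbol
matrix `σ(ξ)` (a complex `(n+1) × (n+1)` matrix) is invertible; equivalently, the real
matrix obtained by dropping the factors `i` is invertible. -/
theorem anisotropic_stokes_ADN_elliptic
    (n : ℕ) (hn : 3 ≤ n) (a : Fin n → Fin n → Fin n → Fin n → ℝ)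
    (cA : ℝ) (hcA : 0 < cA)
    (hsym : ∀ i j α β : Fin n, a i j α β = a α j i β ∧ a i j α β = a i β α j)
    (hell : ∀ ξ : Matrix (Fin n) (Fin n) ℝ, ξ.IsSymm → (∑ i, ξ i i) = 0 →
      cA⁻¹ * (∑ i, ∑ α, ξ i α ^ 2) ≤ ∑ i, ∑ j, ∑ α, ∑ β, a i j α β * ξ i α * ξ j β)
    (ξ : Fin n → ℝ) (hξ : ξ ≠ 0) :
    IsUnit (Matrix.of (fun ℓ j : Fin (n + 1) =>
      if hℓ : (ℓ : ℕ) < n then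
        (if hj : (j : ℕ) < n then
          ((∑ α, ∑ β, ξ α * a ⟨ℓ, hℓ⟩ ⟨j, hj⟩ α β * ξ β : ℝ) : ℂ)
        else -Complex.I * (ξ ⟨ℓ, hℓ⟩ : ℂ))
      else
        (if hj : (j : ℕ) < n then -Complex.I * (ξ ⟨j, hj⟩ : ℂ) else 0))) ∧
    IsUnit (Matrix.of (fun ℓ j : Fin (n + 1) =>
      if hℓ : (ℓ : ℕ) < n then
        (if hj : (j : ℕ) < n then ∑ α, ∑ β, ξ α * a ⟨ℓ, hℓ⟩ ⟨j, hj⟩ α β * ξ β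
        else -ξ ⟨ℓ, hℓ⟩)
      else
        (if hj : (j : ℕ) < n then -ξ ⟨j, hj⟩ else (0 : ℝ)))) := by
  refine (and_iff_right_of_imp fun hreal => ?_).2 ?_
  · let D : Matrix (Fin (n + 1)) (Fin (n + 1)) ℂ :=
      Matrix.diagonal (Fin.lastCases Complex.I fun _ => 1)
    have hD : IsUnit D := by
      rw [Matrix.isUnit_diagonal, Pi.isUnit_iff]
      intro i
      induction i using Fin.lastCases <;> simp
    convert (hD.mul (hreal.map Complex.ofRealHom.mapMatrix)).mul hD using 1
    ext ℓ j
    rw [Matrix.mul_diagonal, Matrix.diagonal_mul]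
    induction ℓ using Fin.lastCases <;> induction j using Fin.lastCases <;>
      simp [mul_comm]
  · rw [← Matrix.mulVec_injective_iff_isUnit, ← Matrix.coe_mulVecLin, injective_iff_map_eq_zero]
    intro w hw
    have hrow (ℓ : Fin n) : (∑ j : Fin n, (∑ α, ∑ β, ξ α * a ℓ j α β * ξ β) * w j.castSucc) =
        ξ ℓ * w (Fin.last n) := by
      have := congrFun hw ℓ.castSucc
      simp [Matrix.mulVec, dotProduct, Fin.sum_univ_castSucc] at this
      linarith
    have hdiv : ∑ j : Fin n, w j.castSucc * ξ j = 0 := by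
      have := congrFun hw (Fin.last n)
      simpa [Matrix.mulVec, dotProduct, Fin.sum_univ_castSucc, mul_comm] using this
    have hv : (fun j : Fin n => w j.castSucc) = 0 := by
      refine eq_zero_of_symbol_form_eq_zero a cA hcA hsym hell hξ hdiv ?_
      simp only [hrow, ← mul_assoc, ← Finset.sum_mul, hdiv, zero_mul]
    obtain ⟨k, hk⟩ := Function.ne_iff.1 hξ
    funext ℓ
    induction ℓ using Fin.lastCases with
    | cast i => exact congrFun hv i
    | last =>
      have hpk := hrow k
      simp only [fun j => show w (Fin.castSucc j) = 0 from congrFun hv j, mul_zero,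
        Finset.sum_const_zero] at hpk
      exact (mul_eq_zero.1 hpk.symm).resolve_left hk
end

section
/- Let n ≥ 3 and let a_{ij}^{αβ} (1 ≤ i,j,α,β ≤ n) be real numbers satisfying the symmetry conditions and the symmetric ellipticity condition with constant c_𝔸 > 0. Let ξ, v ∈ ℝⁿ with Σ_j v_j ξ_j = 0. Then the matrix M = ½(v⊗ξ + ξ⊗v), with entries M_{ℓα} = ½(v_ℓ ξ_α + v_α ξ_ℓ), is symmetric with trace zero and satisfies |M|² = ½|v|²|ξ|²; moreover a_{ℓj}^{αβ} ξ_α ξ_β v_ℓ v_j = a_{ℓj}^{αβ} M_{ℓα} M_{jβ}, and consequently a_{ℓj}^{αβ} ξ_α ξ_β v_ℓ v_j ≥ (1/(2 c_𝔸)) |v|² |ξ|². -/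
open scoped BigOperators

/-- Pairing a symmetric array with a matrix only sees the symmetric part of the matrix. -/
theorem sum_mul_symmetric_part {ι : Type*} [Fintype ι] (c X : ι → ι → ℝ)
    (hc : ∀ i k, c i k = c k i) :
    ∑ i, ∑ k, c i k * ((X i k + X k i) / 2) = ∑ i, ∑ k, c i k * X i k := by
  have hswap : ∑ i, ∑ k, c i k * X k i = ∑ i, ∑ k, c i k * X i k := by
    rw [Finset.sum_comm]
    exact Finset.sum_congr rfl fun i _ => Finset.sum_congr rfl fun k _ => by rw [hc k i]
  calc ∑ i, ∑ k, c i k * ((X i k + X k i) / 2)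
      = (∑ i, ∑ k, c i k * X i k + ∑ i, ∑ k, c i k * X k i) / 2 := by
        simp only [← Finset.sum_add_distrib, Finset.sum_div]
        exact Finset.sum_congr rfl fun i _ => Finset.sum_congr rfl fun k _ => by ring
    _ = ∑ i, ∑ k, c i k * X i k := by rw [hswap]; ring

/-- The quadratic form of a tensor with the two pair symmetries only sees the symmetric part of
its argument. -/
theorem quadratic_form_symmetric_part {ι : Type*} [Fintype ι] (a : ι → ι → ι → ι → ℝ)
    (h₁ : ∀ i j α β, a i j α β = a α j i β) (h₂ : ∀ i j α β, a i j α β = a i β α j)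
    (X : ι → ι → ℝ) :
    ∑ i, ∑ j, ∑ α, ∑ β, a i j α β * ((X i α + X α i) / 2) * ((X j β + X β j) / 2)
      = ∑ i, ∑ j, ∑ α, ∑ β, a i j α β * X i α * X j β := by
  have hregroup : ∀ Y : ι → ι → ℝ,
      ∑ i, ∑ j, ∑ α, ∑ β, a i j α β * Y i α * Y j β
        = ∑ i, ∑ α, (∑ j, ∑ β, a i j α β * Y j β) * Y i α := fun Y => by
    refine Finset.sum_congr rfl fun i _ => ?_
    rw [Finset.sum_comm]
    simp only [Finset.sum_mul, mul_right_comm]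
  rw [hregroup X, hregroup fun i α => (X i α + X α i) / 2]
  simp only [fun i α => sum_mul_symmetric_part (fun j β => a i j α β) X fun j β => h₂ i j α β]
  exact sum_mul_symmetric_part (fun i α => ∑ j, ∑ β, a i j α β * X j β) X fun i α => by
    simp only [h₁ i _ α]

/-- The squared Frobenius norm of the symmetrized product of two orthogonal vectors. -/
theorem sum_sq_symmetrized_product {ι : Type*} [Fintype ι] (ξ v : ι → ℝ)
    (hperp : ∑ j, v j * ξ j = 0) :
    ∑ i, ∑ k, ((v i * ξ k + v k * ξ i) / 2) ^ 2
      = (1 / 2) * (∑ i, v i ^ 2) * (∑ k, ξ k ^ 2) := by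
  calc ∑ i, ∑ k, ((v i * ξ k + v k * ξ i) / 2) ^ 2
      = ((∑ i, v i ^ 2) * (∑ k, ξ k ^ 2) + (∑ i, ξ i ^ 2) * (∑ k, v k ^ 2)
          + 2 * ((∑ i, v i * ξ i) * (∑ k, v k * ξ k))) / 4 := by
        simp only [Finset.sum_mul_sum]
        simp only [Finset.mul_sum, ← Finset.sum_add_distrib, Finset.sum_div]
        exact Finset.sum_congr rfl fun i _ => Finset.sum_congr rfl fun k _ => by ring
    _ = (1 / 2) * (∑ i, v i ^ 2) * (∑ k, ξ k ^ 2) := by rw [hperp]; ring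

/-- Algebraic lemma underlying ellipticity of the symbol: for a coefficient tensor `a`
satisfying the symmetry and symmetric ellipticity conditions, and vectors `ξ, v` with
`v · ξ = 0`, the matrix `M = ½(v ⊗ ξ + ξ ⊗ v)` is symmetric with zero trace, satisfies
`|M|² = ½|v|²|ξ|²`, the quadratic form identity
`a_{ℓj}^{αβ} ξ_α ξ_β v_ℓ v_j = a_{ℓj}^{αβ} M_{ℓα} M_{jβ}` holds, and consequently
`a_{ℓj}^{αβ} ξ_α ξ_β v_ℓ v_j ≥ (1/(2 cA)) |v|² |ξ|²`. -/
theorem symbol_quadratic_form_bound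
    (n : ℕ) (hn : 3 ≤ n) (a : Fin n → Fin n → Fin n → Fin n → ℝ)
    (cA : ℝ) (hcA : 0 < cA)
    (hsym : ∀ i j α β : Fin n, a i j α β = a α j i β ∧ a i j α β = a i β α j)
    (hell : ∀ ζ : Matrix (Fin n) (Fin n) ℝ, ζ.IsSymm → (∑ i, ζ i i) = 0 →
      cA⁻¹ * (∑ i, ∑ α, ζ i α ^ 2) ≤ ∑ i, ∑ j, ∑ α, ∑ β, a i j α β * ζ i α * ζ j β)
    (ξ v : Fin n → ℝ) (hperp : (∑ j, v j * ξ j) = 0) :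
    letI M : Matrix (Fin n) (Fin n) ℝ :=
      Matrix.of fun ℓ α : Fin n => (v ℓ * ξ α + v α * ξ ℓ) / 2
    M.IsSymm ∧ (∑ i, M i i) = 0 ∧
    (∑ ℓ, ∑ α, M ℓ α ^ 2) = (1 / 2) * (∑ ℓ, v ℓ ^ 2) * (∑ α, ξ α ^ 2) ∧
    (∑ ℓ, ∑ j, ∑ α, ∑ β, a ℓ j α β * ξ α * ξ β * v ℓ * v j)
      = (∑ ℓ, ∑ j, ∑ α, ∑ β, a ℓ j α β * M ℓ α * M j β) ∧
    (1 / (2 * cA)) * (∑ ℓ, v ℓ ^ 2) * (∑ α, ξ α ^ 2)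
      ≤ ∑ ℓ, ∑ j, ∑ α, ∑ β, a ℓ j α β * ξ α * ξ β * v ℓ * v j := by
  set M : Matrix (Fin n) (Fin n) ℝ :=
    Matrix.of fun ℓ α : Fin n => (v ℓ * ξ α + v α * ξ ℓ) / 2 with hM
  have hMsymm : M.IsSymm := Matrix.IsSymm.ext fun i k => by
    simp only [hM, Matrix.of_apply]
    ring
  have hMtrace : ∑ i, M i i = 0 := by
    simpa [hM] using hperp
  have hMnorm : ∑ ℓ, ∑ α, M ℓ α ^ 2 = (1 / 2) * (∑ ℓ, v ℓ ^ 2) * (∑ α, ξ α ^ 2) :=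
    sum_sq_symmetrized_product ξ v hperp
  have hform : ∑ ℓ, ∑ j, ∑ α, ∑ β, a ℓ j α β * ξ α * ξ β * v ℓ * v j
      = ∑ ℓ, ∑ j, ∑ α, ∑ β, a ℓ j α β * M ℓ α * M j β := by
    refine Eq.trans ?_ (quadratic_form_symmetric_part a (fun i j α β => (hsym i j α β).1)
      (fun i j α β => (hsym i j α β).2) fun i α => v i * ξ α).symm
    exact Finset.sum_congr rfl fun ℓ _ => Finset.sum_congr rfl fun j _ =>
      Finset.sum_congr rfl fun α _ => Finset.sum_congr rfl fun β _ => by ring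
  refine ⟨hMsymm, hMtrace, hMnorm, hform, ?_⟩
  rw [hform]
  refine le_of_eq_of_le ?_ (hell M hMsymm hMtrace)
  rw [hMnorm]
  field_simp
end

section
/- Let n ≥ 3 and let f : ℝⁿ → ℝ be a smooth compactly supported function. Then ∫_{ℝⁿ} f(x)²/(1 + |x|²) dx ≤ (2/(n−2))² ∫_{ℝⁿ} |∇f(x)|² dx. Consequently, on smooth compactly supported functions the seminorm f ↦ ‖∇f‖_{L²(ℝⁿ)} controls the weighted norm f ↦ (‖ρ^{-1}f‖²_{L²(ℝⁿ)} + ‖∇f‖²_{L²(ℝⁿ)})^{1/2}, where ρ(x) = (1+|x|²)^{1/2}. -/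
open MeasureTheory
open scoped BigOperators

/-- The partial derivatives of the radial field `x ↦ x / (1 + |x|²)`. -/
lemma fderiv_radial_field_apply {n : ℕ} (i : Fin n) (x : EuclideanSpace ℝ (Fin n)) :
    fderiv ℝ (fun y : EuclideanSpace ℝ (Fin n) => y i * (1 + ‖y‖ ^ 2)⁻¹) x
      (EuclideanSpace.single i 1) = (1 + ‖x‖ ^ 2)⁻¹ - 2 * x i ^ 2 * ((1 + ‖x‖ ^ 2)⁻¹) ^ 2 := by
  have hpos : (1 + ‖x‖ ^ 2) ≠ 0 := by positivity
  have hcoord : HasFDerivAt (fun y : EuclideanSpace ℝ (Fin n) => y i)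
      (EuclideanSpace.proj i : EuclideanSpace ℝ (Fin n) →L[ℝ] ℝ) x :=
    (EuclideanSpace.proj i : EuclideanSpace ℝ (Fin n) →L[ℝ] ℝ).hasFDerivAt
  have hnorm := ((hasStrictFDerivAt_norm_sq x).hasFDerivAt.const_add 1)
  have hinv := (hasDerivAt_inv hpos).comp_hasFDerivAt x hnorm
  have h := (hcoord.mul hinv).fderiv
  have h' := congrArg (fun L => L (EuclideanSpace.single i (1 : ℝ))) h
  refine h'.trans ?_
  simp [EuclideanSpace.inner_single_right]
  field_simp
  ring

lemma contDiff_radial_field {n : ℕ} (i : Fin n) :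
    ContDiff ℝ 1 (fun y : EuclideanSpace ℝ (Fin n) => y i * (1 + ‖y‖ ^ 2)⁻¹) := by
  refine ContDiff.mul (EuclideanSpace.proj i : EuclideanSpace ℝ (Fin n) →L[ℝ] ℝ).contDiff
    (ContDiff.inv (contDiff_const.add (contDiff_norm_sq ℝ)) fun y => by positivity)

/-- A derivative of a compactly supported `C¹` function is integrable. -/
lemma integrable_fderiv_apply {n : ℕ} {g : EuclideanSpace ℝ (Fin n) → ℝ}
    (hg : ContDiff ℝ 1 g) (hs : HasCompactSupport g) (v : EuclideanSpace ℝ (Fin n)) :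
    Integrable (fun x => fderiv ℝ g x v) :=
  ((hg.continuous_fderiv one_ne_zero).clm_apply continuous_const).integrable_of_hasCompactSupport
    (hs.fderiv_apply ℝ v)

/-- Testing `f²` against the radial field `x / (1 + |x|²)`: the divergence of `f² x / (1 + |x|²)`
has integral zero. -/
lemma integral_sq_mul_radial_field {n : ℕ} {f : EuclideanSpace ℝ (Fin n) → ℝ}
    (hf : ContDiff ℝ 1 f) (hs : HasCompactSupport f) (i : Fin n) :
    Integrable (fun x => f x ^ 2 * ((1 + ‖x‖ ^ 2)⁻¹ - 2 * x i ^ 2 * ((1 + ‖x‖ ^ 2)⁻¹) ^ 2)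
      + 2 * f x * fderiv ℝ f x (EuclideanSpace.single i 1) * (x i * (1 + ‖x‖ ^ 2)⁻¹)) ∧
    ∫ x, (f x ^ 2 * ((1 + ‖x‖ ^ 2)⁻¹ - 2 * x i ^ 2 * ((1 + ‖x‖ ^ 2)⁻¹) ^ 2)
      + 2 * f x * fderiv ℝ f x (EuclideanSpace.single i 1) * (x i * (1 + ‖x‖ ^ 2)⁻¹)) = 0 := by
  set e : EuclideanSpace ℝ (Fin n) := EuclideanSpace.single i 1
  set F : EuclideanSpace ℝ (Fin n) → ℝ := fun y => y i * (1 + ‖y‖ ^ 2)⁻¹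
  have hFd : ContDiff ℝ 1 F := contDiff_radial_field i
  have hu : ContDiff ℝ 1 (fun x => f x * F x) := hf.mul hFd
  have hus : HasCompactSupport (fun x => f x * F x) := hs.mul_right
  have hdf := integrable_fderiv_apply hf hs e
  have hcf := (hf.continuous_fderiv one_ne_zero).clm_apply (continuous_const (y := e))
  have hcu := (hu.continuous_fderiv one_ne_zero).clm_apply (continuous_const (y := e))
  have h1 : Integrable (fun x => fderiv ℝ (fun x => f x * F x) x e * f x) :=
    (hcu.mul hf.continuous).integrable_of_hasCompactSupport hs.mul_left
  have h2 : Integrable (fun x => f x * F x * fderiv ℝ f x e) :=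
    (hu.continuous.mul hcf).integrable_of_hasCompactSupport hus.mul_right
  have h3 : Integrable (fun x => f x * F x * f x) :=
    (hu.continuous.mul hf.continuous).integrable_of_hasCompactSupport hus.mul_right
  have key := integral_mul_fderiv_eq_neg_fderiv_mul_of_integrable h1 h2 h3
    (fun x _ => hu.differentiable one_ne_zero x) (fun x _ => hf.differentiable one_ne_zero x)
  have hpt : (fun x => f x ^ 2 * ((1 + ‖x‖ ^ 2)⁻¹ - 2 * x i ^ 2 * ((1 + ‖x‖ ^ 2)⁻¹) ^ 2)
      + 2 * f x * fderiv ℝ f x e * F x)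
      = fun x => fderiv ℝ (fun x => f x * F x) x e * f x + f x * F x * fderiv ℝ f x e := by
    funext x
    rw [← fderiv_radial_field_apply i x,
      fderiv_fun_mul (hf.differentiable one_ne_zero x) (hFd.differentiable one_ne_zero x)]
    simp only [add_apply, smul_apply, smul_eq_mul]
    ring
  change Integrable (fun x => f x ^ 2 * ((1 + ‖x‖ ^ 2)⁻¹ - 2 * x i ^ 2 * ((1 + ‖x‖ ^ 2)⁻¹) ^ 2)
      + 2 * f x * fderiv ℝ f x e * F x) ∧ ∫ x, (f x ^ 2 * ((1 + ‖x‖ ^ 2)⁻¹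
      - 2 * x i ^ 2 * ((1 + ‖x‖ ^ 2)⁻¹) ^ 2) + 2 * f x * fderiv ℝ f x e * F x) = 0
  rw [hpt]
  refine ⟨h1.add h2, ?_⟩
  rw [integral_add h1 h2, key, add_neg_cancel]

/-- The pointwise inequality behind the Hardy inequality: completing the square. -/
lemma hardy_pointwise {n : ℕ} (hn : 3 ≤ n) (x : EuclideanSpace ℝ (Fin n)) (a : ℝ)
    (p : Fin n → ℝ) :
    ((n : ℝ) - 2) / 2 * (a ^ 2 / (1 + ‖x‖ ^ 2)) ≤
      ∑ i, (a ^ 2 * ((1 + ‖x‖ ^ 2)⁻¹ - 2 * x i ^ 2 * ((1 + ‖x‖ ^ 2)⁻¹) ^ 2)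
        + 2 * a * p i * (x i * (1 + ‖x‖ ^ 2)⁻¹)) + 2 / ((n : ℝ) - 2) * ∑ i, p i ^ 2 := by
  have hc : 0 < (n : ℝ) - 2 := by
    have : (3 : ℝ) ≤ n := by exact_mod_cast hn
    linarith
  set c := (n : ℝ) - 2 with hcdef
  have hr : ‖x‖ ^ 2 = ∑ i, x i ^ 2 := EuclideanSpace.real_norm_sq_eq x
  set r := ‖x‖ ^ 2
  have hr0 : 0 ≤ r := by positivity
  set w := (1 + r)⁻¹ with hw
  have hw0 : 0 < w := by positivity
  have hrw : r * w = 1 - w := by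
    rw [hw]; field_simp; ring
  have hsq : 0 ≤ 2 / c * ∑ i, (p i + c / 2 * a * w * x i) ^ 2 := by positivity
  have hexp : 2 / c * ∑ i, (p i + c / 2 * a * w * x i) ^ 2 = 2 / c * ∑ i, p i ^ 2
      + 2 * a * w * ∑ i, p i * x i + c / 2 * a ^ 2 * w ^ 2 * r := by
    rw [hr]
    simp only [Finset.mul_sum, ← Finset.sum_add_distrib]
    refine Finset.sum_congr rfl fun i _ => ?_
    field_simp
    ring
  have hdiv : ∑ i, (a ^ 2 * (w - 2 * x i ^ 2 * w ^ 2) + 2 * a * p i * (x i * w))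
      = a ^ 2 * ((c + 2) * w - 2 * r * w ^ 2) + 2 * a * w * ∑ i, p i * x i := by
    rw [show a ^ 2 * ((c + 2) * w - 2 * r * w ^ 2) = ∑ i, a ^ 2 * (w - 2 * x i ^ 2 * w ^ 2) by
      rw [← Finset.mul_sum, Finset.sum_sub_distrib, ← Finset.sum_mul, ← Finset.mul_sum, ← hr]
      simp [hcdef], Finset.mul_sum, ← Finset.sum_add_distrib]
    exact Finset.sum_congr rfl fun i _ => by ring
  rw [hdiv, div_eq_mul_inv (a ^ 2), ← hw]
  have h2 : r * w ^ 2 = w - w ^ 2 := by linear_combination w * hrw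
  have h3 : 0 ≤ (c / 2 + 2) * (a ^ 2 * w ^ 2) := by positivity
  linear_combination hsq + hexp + h3 + (c / 2 + 2) * a ^ 2 * h2

/-- **Hardy-type inequality in the weighted Sobolev space `ℋ¹(ℝⁿ)`** (`n ≥ 3`): for every
smooth compactly supported `f`, `∫ f²/(1+|x|²) ≤ (2/(n-2))² ∫ |∇f|²`. Consequently the
seminorm `‖∇f‖_{L²}` controls the full weighted norm
`(‖ρ⁻¹f‖²_{L²} + ‖∇f‖²_{L²})^{1/2}` with `ρ(x) = (1+|x|²)^{1/2}`. -/
theorem weighted_hardy_inequality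
    (n : ℕ) (hn : 3 ≤ n)
    (f : EuclideanSpace ℝ (Fin n) → ℝ)
    (hf : ContDiff ℝ (⊤ : ℕ∞) f) (hsupp : HasCompactSupport f) :
    (∫ x, f x ^ 2 / (1 + ‖x‖ ^ 2))
      ≤ (2 / ((n : ℝ) - 2)) ^ 2 * ∫ x, ∑ i, (fderiv ℝ f x (EuclideanSpace.single i 1)) ^ 2 ∧
    Real.sqrt ((∫ x, f x ^ 2 / (1 + ‖x‖ ^ 2))
        + ∫ x, ∑ i, (fderiv ℝ f x (EuclideanSpace.single i 1)) ^ 2)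
      ≤ Real.sqrt (1 + (2 / ((n : ℝ) - 2)) ^ 2) *
        Real.sqrt (∫ x, ∑ i, (fderiv ℝ f x (EuclideanSpace.single i 1)) ^ 2) := by
  have hc : 0 < (n : ℝ) - 2 := by
    have : (3 : ℝ) ≤ n := by exact_mod_cast hn
    linarith
  have hf1 : ContDiff ℝ 1 f := hf.of_le (by exact_mod_cast le_top)
  have hgrad : Integrable (fun x => ∑ i, (fderiv ℝ f x (EuclideanSpace.single i 1)) ^ 2) := by
    refine integrable_finsetSum _ fun i _ => ?_
    have hcont := (hf1.continuous_fderiv one_ne_zero).clm_apply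
      (continuous_const (y := EuclideanSpace.single i (1 : ℝ)))
    simp only [sq]
    exact (hcont.mul hcont).integrable_of_hasCompactSupport (hsupp.fderiv_apply ℝ _).mul_right
  have hweight : Integrable (fun x => f x ^ 2 / (1 + ‖x‖ ^ 2)) := by
    have hcont : Continuous (fun x => f x * (f x / (1 + ‖x‖ ^ 2))) :=
      hf.continuous.mul (hf.continuous.div (by fun_prop) fun x => by positivity)
    refine (hcont.integrable_of_hasCompactSupport hsupp.mul_right).congr (.of_forall fun x => ?_)
    ring
  have hfield := fun i => integral_sq_mul_radial_field hf1 hsupp i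
  have hint := integral_mono (hweight.const_mul (((n : ℝ) - 2) / 2))
    ((integrable_finsetSum Finset.univ fun i _ => (hfield i).1).add
      (hgrad.const_mul (2 / ((n : ℝ) - 2))))
    fun x => hardy_pointwise hn x (f x) fun i => fderiv ℝ f x (EuclideanSpace.single i 1)
  simp only [Pi.add_apply] at hint
  rw [integral_add (integrable_finsetSum Finset.univ fun i _ => (hfield i).1)
    (hgrad.const_mul _), integral_finsetSum _ fun i _ => (hfield i).1,
    Finset.sum_eq_zero fun i _ => (hfield i).2, zero_add, integral_const_mul,
    integral_const_mul] at hint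
  have hardy : (∫ x, f x ^ 2 / (1 + ‖x‖ ^ 2)) ≤ (2 / ((n : ℝ) - 2)) ^ 2 *
      ∫ x, ∑ i, (fderiv ℝ f x (EuclideanSpace.single i 1)) ^ 2 := by
    have h := mul_le_mul_of_nonneg_left hint (show 0 ≤ 2 / ((n : ℝ) - 2) by positivity)
    rwa [← mul_assoc, ← mul_assoc, div_mul_div_cancel₀ hc.ne', div_self two_ne_zero, one_mul,
      ← sq] at h
  refine ⟨hardy, ?_⟩
  rw [← Real.sqrt_mul (by positivity)]
  exact Real.sqrt_le_sqrt (by linarith)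
end

section
/- Let Ω ⊂ ℝ³ be an open set of finite Lebesgue measure |Ω|, and let v, w : ℝ³ → ℝ³ be smooth vector fields with compact support contained in Ω such that div v = 0. Then |∫_{ℝ³} Σ_{i,j} vᵢ(x) ∂ᵢvⱼ(x) wⱼ(x) dx| ≤ (4/3) |Ω|^{1/6} (∫_{ℝ³} |∇v(x)|² dx) (∫_{ℝ³} |∇w(x)|² dx)^{1/2}; that is, the H^{-1}-type norm of the convective term (v·∇)v tested against gradients is bounded by (4/3)|Ω|^{1/6} times the square of the Dirichlet norm of v. -/
open MeasureTheory
open scoped BigOperators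

/-- The partial derivative `∂_α w(x)` of a vector field `w : ℝ³ → ℝ³`. -/
noncomputable def vpder3 (w : EuclideanSpace ℝ (Fin 3) → EuclideanSpace ℝ (Fin 3))
    (α : Fin 3) (x : EuclideanSpace ℝ (Fin 3)) : EuclideanSpace ℝ (Fin 3) :=
  fderiv ℝ w x (EuclideanSpace.single α 1)

open scoped ENNReal InnerProductSpace

lemma HasCompactSupport.two_mul_abs_le_integral_abs_deriv {f : ℝ → ℝ} (hf : ContDiff ℝ 1 f)
    (h : HasCompactSupport f) (t : ℝ) : 2 * |f t| ≤ ∫ s, |deriv f s| := by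
  have hint : Integrable (deriv f) :=
    (hf.continuous_deriv le_rfl).integrable_of_hasCompactSupport h.deriv
  have hle : |f t| ≤ ∫ s in Set.Iic t, |deriv f s| := by
    rw [← h.integral_Iic_deriv_eq hf t]
    exact abs_integral_le_integral_abs
  have hge : |f t| ≤ ∫ s in Set.Ioi t, |deriv f s| := by
    rw [← abs_neg, ← h.integral_Ioi_deriv_eq hf t]
    exact abs_integral_le_integral_abs
  have hsum := intervalIntegral.integral_Iic_add_Ioi (b := t) hint.abs.integrableOn
    hint.abs.integrableOn
  linarith

lemma enorm_pow_four_le_lintegral_enorm_deriv {F : Type*} [NormedAddCommGroup F]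
    [InnerProductSpace ℝ F] {g : ℝ → F} (hg : ContDiff ℝ 1 g) (h : HasCompactSupport g) (t : ℝ) :
    ‖g t‖ₑ ^ 4 ≤ 2 * ∫⁻ s, ‖g s‖ₑ ^ 3 * ‖deriv g s‖ₑ := by
  have hf : ContDiff ℝ 1 fun s ↦ (‖g s‖ ^ 2) ^ 2 := (hg.norm_sq ℝ).pow 2
  have hfc : HasCompactSupport fun s ↦ (‖g s‖ ^ 2) ^ 2 :=
    h.comp_left (g := fun y : F ↦ (‖y‖ ^ 2) ^ 2) (by simp)
  have hderiv (s : ℝ) : |deriv (fun s ↦ (‖g s‖ ^ 2) ^ 2) s| ≤ 4 * (‖g s‖ ^ 3 * ‖deriv g s‖) := by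
    have hd := ((hg.differentiable one_ne_zero s).hasDerivAt.norm_sq.pow 2).deriv
    simp only [Pi.pow_def] at hd
    rw [hd]
    have := abs_real_inner_le_norm (g s) (deriv g s)
    simp only [abs_mul, Nat.cast_ofNat, abs_pow, abs_norm, Nat.abs_ofNat,
      Nat.add_one_sub_one, pow_one]
    nlinarith [mul_le_mul_of_nonneg_left this (sq_nonneg ‖g s‖)]
  have hcont : Continuous fun s ↦ ‖g s‖ ^ 3 * ‖deriv g s‖ := by
    have := hg.continuous
    have := hg.continuous_deriv le_rfl
    fun_prop
  have hint : Integrable fun s ↦ ‖g s‖ ^ 3 * ‖deriv g s‖ :=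
    hcont.integrable_of_hasCompactSupport (h.deriv.norm.mul_left)
  have key : ‖g t‖ ^ 4 ≤ 2 * ∫ s, ‖g s‖ ^ 3 * ‖deriv g s‖ := by
    have h1 := hfc.two_mul_abs_le_integral_abs_deriv hf t
    have h2 := integral_mono (((hf.continuous_deriv le_rfl).integrable_of_hasCompactSupport
      hfc.deriv).abs) (hint.const_mul 4) hderiv
    rw [integral_const_mul] at h2
    rw [abs_of_nonneg (by positivity)] at h1
    linarith
  have := ENNReal.ofReal_le_ofReal key
  rw [ENNReal.ofReal_mul zero_le_two,
    ofReal_integral_eq_lintegral_ofReal hint (ae_of_all _ fun _ ↦ by positivity)] at this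
  simpa [ENNReal.ofReal_pow, ENNReal.ofReal_mul, ofReal_norm] using this

lemma lintegral_sqrt_mul_sqrt_le {α : Type*} [MeasurableSpace α] {μ : Measure α} {f g : α → ℝ≥0∞}
    (hf : Measurable f) (hg : Measurable g) :
    ∫⁻ a, f a ^ (1 / 2 : ℝ) * g a ^ (1 / 2 : ℝ) ∂μ
      ≤ (∫⁻ a, f a ∂μ) ^ (1 / 2 : ℝ) * (∫⁻ a, g a ∂μ) ^ (1 / 2 : ℝ) :=
  ENNReal.lintegral_mul_norm_pow_le hf.aemeasurable hg.aemeasurable (by norm_num) (by norm_num)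
    (by norm_num)

/-- The **Loomis–Whitney inequality** for three variables. -/
lemma lintegral_loomis_whitney {α β γ : Type*} [MeasurableSpace α] [MeasurableSpace β]
    [MeasurableSpace γ] {μ : Measure α} {ν : Measure β} {ρ : Measure γ} [SFinite ν] [SFinite ρ]
    {f : β → γ → ℝ≥0∞} {g : α → γ → ℝ≥0∞} {h : α → β → ℝ≥0∞}
    (hf : Measurable f.uncurry) (hg : Measurable g.uncurry) (hh : Measurable h.uncurry) :
    ∫⁻ x, ∫⁻ y, ∫⁻ z, f y z ^ (1 / 2 : ℝ) * g x z ^ (1 / 2 : ℝ) * h x y ^ (1 / 2 : ℝ) ∂ρ ∂ν ∂μ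
      ≤ (∫⁻ y, ∫⁻ z, f y z ∂ρ ∂ν) ^ (1 / 2 : ℝ) * (∫⁻ x, ∫⁻ z, g x z ∂ρ ∂μ) ^ (1 / 2 : ℝ) *
        (∫⁻ x, ∫⁻ y, h x y ∂ν ∂μ) ^ (1 / 2 : ℝ) := by
  have hF : Measurable fun y ↦ ∫⁻ z, f y z ∂ρ := hf.lintegral_prod_right'
  have hG : Measurable fun x ↦ ∫⁻ z, g x z ∂ρ := hg.lintegral_prod_right'
  have hH : Measurable fun x ↦ ∫⁻ y, h x y ∂ν := hh.lintegral_prod_right'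
  calc
    _ ≤ ∫⁻ x, ∫⁻ y, (∫⁻ z, f y z ∂ρ) ^ (1 / 2 : ℝ) * (∫⁻ z, g x z ∂ρ) ^ (1 / 2 : ℝ) *
          h x y ^ (1 / 2 : ℝ) ∂ν ∂μ := by
      gcongr with x y
      rw [lintegral_mul_const _ (by fun_prop)]
      gcongr
      exact lintegral_sqrt_mul_sqrt_le (by fun_prop) (by fun_prop)
    _ = ∫⁻ x, (∫⁻ z, g x z ∂ρ) ^ (1 / 2 : ℝ) *
          ∫⁻ y, (∫⁻ z, f y z ∂ρ) ^ (1 / 2 : ℝ) * h x y ^ (1 / 2 : ℝ) ∂ν ∂μ := by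
      congr! 2 with x
      rw [← lintegral_const_mul _ (by fun_prop)]
      congr! 2 with y
      ring
    _ ≤ ∫⁻ x, (∫⁻ z, g x z ∂ρ) ^ (1 / 2 : ℝ) *
          ((∫⁻ y, ∫⁻ z, f y z ∂ρ ∂ν) ^ (1 / 2 : ℝ) * (∫⁻ y, h x y ∂ν) ^ (1 / 2 : ℝ)) ∂μ := by
      gcongr with x
      exact lintegral_sqrt_mul_sqrt_le hF (by fun_prop)
    _ = (∫⁻ y, ∫⁻ z, f y z ∂ρ ∂ν) ^ (1 / 2 : ℝ) *
          ∫⁻ x, (∫⁻ z, g x z ∂ρ) ^ (1 / 2 : ℝ) * (∫⁻ y, h x y ∂ν) ^ (1 / 2 : ℝ) ∂μ := by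
      rw [← lintegral_const_mul _ (by fun_prop)]
      congr! 2 with x
      ring
    _ ≤ _ := by
      rw [mul_assoc]
      gcongr
      exact lintegral_sqrt_mul_sqrt_le hG hH

lemma EuclideanSpace.lintegral_fin_three {f : EuclideanSpace ℝ (Fin 3) → ℝ≥0∞}
    (hf : Measurable f) : ∫⁻ x, f x = ∫⁻ a, ∫⁻ b, ∫⁻ c, f !₂[a, b, c] := by
  rw [← (PiLp.volume_preserving_toLp (Fin 3)).lintegral_comp hf,
    ← (volume_preserving_piFinSuccAbove (fun _ : Fin 3 ↦ ℝ) 0).symm.lintegral_comp (by fun_prop),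
    Measure.volume_eq_prod, lintegral_prod _ (by fun_prop)]
  congr! 2 with a
  rw [← (volume_preserving_finTwoArrow ℝ).symm.lintegral_comp (by fun_prop),
    Measure.volume_eq_prod, lintegral_prod _ (by fun_prop)]
  congr! 6 with b c
  ext i
  fin_cases i <;> rfl

lemma continuous_fderiv_apply_const {E F : Type*} [NormedAddCommGroup E] [NormedSpace ℝ E]
    [NormedAddCommGroup F] [NormedSpace ℝ F] {u : E → F} (hu : ContDiff ℝ 1 u) (e : E) :
    Continuous fun x ↦ fderiv ℝ u x e :=
  (hu.continuous_fderiv one_ne_zero).clm_apply continuous_const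

lemma enorm_pow_four_le_lintegral_enorm_fderiv {E F : Type*} [NormedAddCommGroup E]
    [NormedSpace ℝ E] [NormedAddCommGroup F] [InnerProductSpace ℝ F] {u : E → F}
    (hu : ContDiff ℝ 1 u) (h : HasCompactSupport u) {e : E} (he : e ≠ 0) {γ : ℝ → E}
    (hγ : ∀ t, γ t = γ 0 + t • e) (t : ℝ) :
    ‖u (γ t)‖ₑ ^ 4 ≤ 2 * ∫⁻ s, ‖u (γ s)‖ₑ ^ 3 * ‖fderiv ℝ u (γ s) e‖ₑ := by
  obtain ⟨p, rfl⟩ : ∃ p, γ = fun t ↦ p + t • e := ⟨γ 0, funext hγ⟩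
  have hγd (s : ℝ) : HasDerivAt (fun t : ℝ ↦ p + t • e) e s := by
    simpa using ((hasDerivAt_id s).smul_const e).const_add p
  have hemb : Topology.IsClosedEmbedding fun t : ℝ ↦ p + t • e :=
    (Homeomorph.addLeft p).isClosedEmbedding.comp (isClosedEmbedding_smul_left he)
  have hd (s : ℝ) : deriv (u ∘ fun t : ℝ ↦ p + t • e) s = fderiv ℝ u (p + s • e) e :=
    ((hu.differentiable one_ne_zero _).hasFDerivAt.comp_hasDerivAt s (hγd s)).deriv
  have := enorm_pow_four_le_lintegral_enorm_deriv (hu.comp (by fun_prop))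
    (h.comp_isClosedEmbedding hemb) t
  simpa only [hd, Function.comp_apply] using this

lemma lintegral_enorm_pow_six_le {F : Type*} [NormedAddCommGroup F] [InnerProductSpace ℝ F]
    {u : EuclideanSpace ℝ (Fin 3) → F} (hu : ContDiff ℝ 1 u) (h : HasCompactSupport u) :
    (∫⁻ x, ‖u x‖ₑ ^ 6) ^ 2
      ≤ ∏ i, (2 * ∫⁻ x, ‖u x‖ₑ ^ 3 * ‖fderiv ℝ u x (EuclideanSpace.single i 1)‖ₑ) := by
  set H : Fin 3 → EuclideanSpace ℝ (Fin 3) → ℝ≥0∞ := fun i x ↦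
    ‖u x‖ₑ ^ 3 * ‖fderiv ℝ u x (EuclideanSpace.single i 1)‖ₑ with hH
  have hHm (i) : Measurable (H i) :=
    (hu.continuous.enorm.measurable.pow_const 3).mul
      (continuous_fderiv_apply_const hu (EuclideanSpace.single i 1)).enorm.measurable
  have hline (i : Fin 3) {γ : ℝ → EuclideanSpace ℝ (Fin 3)}
      (hγ : ∀ t, γ t = γ 0 + t • EuclideanSpace.single i 1) (t : ℝ) :
      ‖u (γ t)‖ₑ ^ 4 ≤ 2 * ∫⁻ s, H i (γ s) :=
    enorm_pow_four_le_lintegral_enorm_fderiv hu h (by simp) hγ t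
  have hpow (r : ℝ≥0∞) : r ^ 6 = (r ^ 4) ^ (1 / 2 : ℝ) * (r ^ 4) ^ (1 / 2 : ℝ) *
      (r ^ 4) ^ (1 / 2 : ℝ) := by
    have : (r ^ 4) ^ (1 / 2 : ℝ) = r ^ 2 := by
      rw [← ENNReal.rpow_natCast, ← ENNReal.rpow_natCast, ← ENNReal.rpow_mul]
      norm_num
    rw [this]
    ring
  have hm0 : Measurable (Function.uncurry fun b c ↦ 2 * ∫⁻ t, H 0 !₂[t, b, c]) :=
    (Measurable.lintegral_prod_right' (f := fun p : (ℝ × ℝ) × ℝ ↦ H 0 !₂[p.2, p.1.1, p.1.2])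
      (by fun_prop)).const_mul 2
  have hm1 : Measurable (Function.uncurry fun a c ↦ 2 * ∫⁻ t, H 1 !₂[a, t, c]) :=
    (Measurable.lintegral_prod_right' (f := fun p : (ℝ × ℝ) × ℝ ↦ H 1 !₂[p.1.1, p.2, p.1.2])
      (by fun_prop)).const_mul 2
  have hm2 : Measurable (Function.uncurry fun a b ↦ 2 * ∫⁻ t, H 2 !₂[a, b, t]) :=
    (Measurable.lintegral_prod_right' (f := fun p : (ℝ × ℝ) × ℝ ↦ H 2 !₂[p.1.1, p.1.2, p.2])
      (by fun_prop)).const_mul 2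
  have hF0 : ∫⁻ b, ∫⁻ c, 2 * ∫⁻ t, H 0 !₂[t, b, c] = 2 * ∫⁻ x, H 0 x := by
    have hm : Measurable (Function.uncurry fun a b ↦ ∫⁻ c, H 0 !₂[a, b, c]) :=
      Measurable.lintegral_prod_right' (f := fun p : (ℝ × ℝ) × ℝ ↦ H 0 !₂[p.1.1, p.1.2, p.2])
        (by fun_prop)
    simp only [lintegral_const_mul' 2 _ ENNReal.ofNat_ne_top]
    rw [EuclideanSpace.lintegral_fin_three (hHm 0), lintegral_lintegral_swap (ν := volume)
      (f := fun a b ↦ ∫⁻ c, H 0 !₂[a, b, c]) hm.aemeasurable]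
    congr! 3 with b
    exact lintegral_lintegral_swap (by fun_prop)
  have hF1 : ∫⁻ a, ∫⁻ c, 2 * ∫⁻ t, H 1 !₂[a, t, c] = 2 * ∫⁻ x, H 1 x := by
    simp only [lintegral_const_mul' 2 _ ENNReal.ofNat_ne_top]
    rw [EuclideanSpace.lintegral_fin_three (hHm 1)]
    congr! 3 with a
    exact lintegral_lintegral_swap (by fun_prop)
  have hF2 : ∫⁻ a, ∫⁻ b, 2 * ∫⁻ t, H 2 !₂[a, b, t] = 2 * ∫⁻ x, H 2 x := by
    simp only [lintegral_const_mul' 2 _ ENNReal.ofNat_ne_top]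
    rw [EuclideanSpace.lintegral_fin_three (hHm 2)]
  have key : ∫⁻ x, ‖u x‖ₑ ^ 6 ≤ (2 * ∫⁻ x, H 0 x) ^ (1 / 2 : ℝ) * (2 * ∫⁻ x, H 1 x) ^ (1 / 2 : ℝ) *
      (2 * ∫⁻ x, H 2 x) ^ (1 / 2 : ℝ) := by
    rw [EuclideanSpace.lintegral_fin_three (hu.continuous.enorm.measurable.pow_const 6), ← hF0,
      ← hF1, ← hF2]
    refine le_trans ?_ (lintegral_loomis_whitney hm0 hm1 hm2)
    gcongr with a b c
    rw [hpow]
    gcongr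
    · exact hline 0 (γ := fun t ↦ !₂[t, b, c]) (fun t ↦ by ext i; fin_cases i <;> simp) a
    · exact hline 1 (γ := fun t ↦ !₂[a, t, c]) (fun t ↦ by ext i; fin_cases i <;> simp) b
    · exact hline 2 (γ := fun t ↦ !₂[a, b, t]) (fun t ↦ by ext i; fin_cases i <;> simp) c
  have hsq (r : ℝ≥0∞) : (r ^ (1 / 2 : ℝ)) ^ 2 = r := by
    rw [← ENNReal.rpow_natCast, ← ENNReal.rpow_mul]
    norm_num
  calc
    _ ≤ _ := pow_le_pow_left' key 2
    _ = _ := by simp only [mul_pow, hsq, Fin.prod_univ_three, hH]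

lemma sq_integral_mul_le {α : Type*} [TopologicalSpace α] [MeasurableSpace α]
    [OpensMeasurableSpace α] {μ : Measure α} [IsFiniteMeasureOnCompacts μ] {f g : α → ℝ}
    (hf : Continuous f) (hg : Continuous g) (hfc : HasCompactSupport f) (hgc : HasCompactSupport g)
    (hf0 : 0 ≤ f) (hg0 : 0 ≤ g) :
    (∫ x, f x * g x ∂μ) ^ 2 ≤ (∫ x, f x ^ 2 ∂μ) * ∫ x, g x ^ 2 ∂μ := by
  have := integral_mul_le_Lp_mul_Lq_of_nonneg (μ := μ) Real.HolderConjugate.two_two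
    (ae_of_all _ hf0) (ae_of_all _ hg0) (hf.memLp_of_hasCompactSupport hfc)
    (hg.memLp_of_hasCompactSupport hgc)
  simp only [Real.rpow_two, ← Real.sqrt_eq_rpow] at this
  rw [← Real.sqrt_mul (integral_nonneg fun _ ↦ sq_nonneg _)] at this
  refine (pow_le_pow_left₀ (integral_nonneg fun x ↦ mul_nonneg (hf0 x) (hg0 x)) this 2).trans_eq ?_
  exact Real.sq_sqrt (mul_nonneg (integral_nonneg fun _ ↦ sq_nonneg _)
    (integral_nonneg fun _ ↦ sq_nonneg _))

lemma HasCompactSupport.norm_pow {α F : Type*} [TopologicalSpace α] [NormedAddCommGroup F]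
    {u : α → F} (h : HasCompactSupport u) {n : ℕ} (hn : n ≠ 0) :
    HasCompactSupport fun x ↦ ‖u x‖ ^ n :=
  h.comp_left (g := fun y : F ↦ ‖y‖ ^ n) (by simp [hn])

/-- The **Sobolev inequality** `‖u‖_{L⁶} ≤ (2 / √3) ‖∇u‖_{L²}` in dimension three. -/
lemma integral_norm_pow_six_le {F : Type*} [NormedAddCommGroup F] [InnerProductSpace ℝ F]
    {u : EuclideanSpace ℝ (Fin 3) → F} (hu : ContDiff ℝ 1 u) (h : HasCompactSupport u) :
    ∫ x, ‖u x‖ ^ 6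
      ≤ (4 / 3 * ∑ i, ∫ x, ‖fderiv ℝ u x (EuclideanSpace.single i 1)‖ ^ 2) ^ 3 := by
  have huc := hu.continuous
  have hdc (i : Fin 3) := continuous_fderiv_apply_const hu (EuclideanSpace.single i 1)
  have hds (i : Fin 3) : HasCompactSupport fun x ↦ fderiv ℝ u x (EuclideanSpace.single i 1) :=
    h.fderiv_apply ℝ _
  set S := ∫ x, ‖u x‖ ^ 6 with hS
  set D : Fin 3 → ℝ := fun i ↦ ∫ x, ‖fderiv ℝ u x (EuclideanSpace.single i 1)‖ ^ 2
  set H : Fin 3 → ℝ := fun i ↦ ∫ x, ‖u x‖ ^ 3 * ‖fderiv ℝ u x (EuclideanSpace.single i 1)‖ with hH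
  have hS0 : 0 ≤ S := integral_nonneg fun _ ↦ by positivity
  have hD0 (i) : 0 ≤ D i := integral_nonneg fun _ ↦ by positivity
  have hH0 (i) : 0 ≤ H i := integral_nonneg fun _ ↦ by positivity
  have hHD (i) : H i ^ 2 ≤ S * D i := by
    have := sq_integral_mul_le (μ := volume) (f := fun x ↦ ‖u x‖ ^ 3) (huc.norm.pow 3)
      (hdc i).norm (h.norm_pow three_ne_zero) (hds i).norm (fun _ ↦ by positivity)
      (fun _ ↦ norm_nonneg _)
    simpa only [← pow_mul, Nat.reduceMul] using this
  have hSH : S ^ 2 ≤ 8 * (H 0 * H 1 * H 2) := by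
    have hSe : ENNReal.ofReal S = ∫⁻ x, ‖u x‖ₑ ^ 6 := by
      have hint : Integrable fun x ↦ ‖u x‖ ^ 6 :=
        (huc.norm.pow 6).integrable_of_hasCompactSupport (h.norm_pow (by norm_num))
      rw [hS, ofReal_integral_eq_lintegral_ofReal hint (ae_of_all _ fun _ ↦ by positivity)]
      simp [ENNReal.ofReal_pow, ofReal_norm]
    have hHe (i) : ENNReal.ofReal (H i) =
        ∫⁻ x, ‖u x‖ₑ ^ 3 * ‖fderiv ℝ u x (EuclideanSpace.single i 1)‖ₑ := by
      have hint : Integrable fun x ↦ ‖u x‖ ^ 3 * ‖fderiv ℝ u x (EuclideanSpace.single i 1)‖ :=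
        ((huc.norm.pow 3).mul (hdc i).norm).integrable_of_hasCompactSupport (hds i).norm.mul_left
      simp only [hH]
      rw [ofReal_integral_eq_lintegral_ofReal hint (ae_of_all _ fun _ ↦ by positivity)]
      simp [ENNReal.ofReal_pow, ENNReal.ofReal_mul, ofReal_norm]
    have := lintegral_enorm_pow_six_le hu h
    simp only [← hSe, ← hHe, Fin.prod_univ_three] at this
    rw [← ENNReal.ofReal_pow hS0, ← ENNReal.ofReal_ofNat 2] at this
    have h2 (i) : 0 ≤ 2 * H i := mul_nonneg zero_le_two (hH0 i)
    rw [← ENNReal.ofReal_mul zero_le_two, ← ENNReal.ofReal_mul zero_le_two,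
      ← ENNReal.ofReal_mul zero_le_two, ← ENNReal.ofReal_mul (h2 0),
      ← ENNReal.ofReal_mul (mul_nonneg (h2 0) (h2 1)), ENNReal.ofReal_le_ofReal_iff
      (mul_nonneg (mul_nonneg (h2 0) (h2 1)) (h2 2))] at this
    linarith
  have hS4 : S ^ 4 ≤ 64 * (S ^ 3 * (D 0 * D 1 * D 2)) := by
    calc
      S ^ 4 = (S ^ 2) ^ 2 := by ring
      _ ≤ (8 * (H 0 * H 1 * H 2)) ^ 2 := by gcongr
      _ = 64 * (H 0 ^ 2 * H 1 ^ 2 * H 2 ^ 2) := by ring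
      _ ≤ 64 * ((S * D 0) * (S * D 1) * (S * D 2)) := by
        have := hD0 0
        have := hD0 1
        gcongr <;> apply hHD
      _ = _ := by ring
  have hamgm : 27 * (D 0 * D 1 * D 2) ≤ (D 0 + D 1 + D 2) ^ 3 := by
    nlinarith [mul_nonneg (hD0 0) (sq_nonneg (D 1 - D 2)), mul_nonneg (hD0 1) (sq_nonneg (D 0 - D 2)),
      mul_nonneg (hD0 2) (sq_nonneg (D 1 - D 0)), mul_nonneg (hD0 0) (sq_nonneg (D 1 - D 0)),
      mul_nonneg (hD0 0) (sq_nonneg (D 2 - D 0)), mul_nonneg (hD0 1) (sq_nonneg (D 1 - D 0)),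
      mul_nonneg (hD0 1) (sq_nonneg (D 1 - D 2)), mul_nonneg (hD0 2) (sq_nonneg (D 2 - D 0)),
      mul_nonneg (hD0 2) (sq_nonneg (D 2 - D 1))]
  rw [Fin.sum_univ_three, mul_pow]
  rcases hS0.eq_or_lt with h0 | h0
  · rw [← h0]
    have := add_nonneg (add_nonneg (hD0 0) (hD0 1)) (hD0 2)
    positivity
  · have : S ≤ 64 * (D 0 * D 1 * D 2) :=
      le_of_mul_le_mul_left (by linarith) (pow_pos h0 3)
    linarith

/-- Hölder's inequality: an `L⁴` bound in terms of `L⁶` on a set of finite measure. -/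
lemma integral_norm_pow_four_le {α F : Type*} [TopologicalSpace α] [MeasurableSpace α]
    [OpensMeasurableSpace α] [NormedAddCommGroup F] {μ : Measure α} [IsFiniteMeasureOnCompacts μ]
    {u : α → F} (hu : Continuous u) (h : HasCompactSupport u) {s : Set α} (hs : μ s ≠ ⊤)
    (hus : Function.support u ⊆ s) :
    ∫ x, ‖u x‖ ^ 4 ∂μ
      ≤ (∫ x, ‖u x‖ ^ 6 ∂μ) ^ (2 / 3 : ℝ) * (μ s).toReal ^ (1 / 3 : ℝ) := by
  have : IsFiniteMeasure (μ.restrict s) := ⟨by simpa using hs.lt_top⟩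
  have hpq : (3 / 2 : ℝ).HolderConjugate 3 := by
    rw [Real.holderConjugate_iff]
    norm_num
  have hset {n : ℕ} (hn : n ≠ 0) : ∫ x in s, ‖u x‖ ^ n ∂μ = ∫ x, ‖u x‖ ^ n ∂μ :=
    setIntegral_eq_integral_of_forall_compl_eq_zero fun x hx ↦ by
      rw [Function.notMem_support.mp fun hx' ↦ hx (hus hx'), norm_zero, zero_pow hn]
  have hf : MemLp (fun x ↦ ‖u x‖ ^ 4) (ENNReal.ofReal (3 / 2)) (μ.restrict s) :=
    ((hu.norm.pow 4).memLp_of_hasCompactSupport (h.norm_pow four_ne_zero)).restrict s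
  have key := integral_mul_le_Lp_mul_Lq_of_nonneg hpq (ae_of_all _ fun _ ↦ by positivity)
    (ae_of_all _ fun _ ↦ zero_le_one) hf (memLp_const (1 : ℝ))
  have hpow (r : ℝ) (hr : 0 ≤ r) : (r ^ 4) ^ (3 / 2 : ℝ) = r ^ 6 := by
    rw [← Real.rpow_natCast, ← Real.rpow_natCast, ← Real.rpow_mul hr]
    norm_num
  simp only [hpow _ (norm_nonneg _), mul_one, Real.one_rpow, hset four_ne_zero,
    hset (n := 6) (by norm_num)] at key
  simpa [Measure.real] using key

/-- Antisymmetry of the convective trilinear form of a divergence-free field. -/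
lemma integral_convective_eq_neg {E ι F : Type*} [NormedAddCommGroup E] [NormedSpace ℝ E]
    [MeasurableSpace E] [BorelSpace E] [FiniteDimensional ℝ E] {μ : Measure E}
    [μ.IsAddHaarMeasure] [NormedAddCommGroup F] [InnerProductSpace ℝ F] [Fintype ι]
    {e : ι → E} {a : ι → E → ℝ} {u w : E → F} (ha : ∀ i, ContDiff ℝ 1 (a i))
    (hu : ContDiff ℝ 1 u) (hw : ContDiff ℝ 1 w) (hw' : HasCompactSupport w)
    (hdiv : ∀ x, ∑ i, fderiv ℝ (a i) x (e i) = 0) :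
    ∫ x, ∑ i, a i x * ⟪fderiv ℝ u x (e i), w x⟫_ℝ ∂μ
      = -∫ x, ∑ i, a i x * ⟪u x, fderiv ℝ w x (e i)⟫_ℝ ∂μ := by
  have hb : ContDiff ℝ 1 fun x ↦ ⟪u x, w x⟫_ℝ := hu.inner ℝ hw
  have hc (i : ι) := continuous_fderiv_apply_const (ha i) (e i)
  have huc (i : ι) := continuous_fderiv_apply_const hu (e i)
  have hwc (i : ι) := continuous_fderiv_apply_const hw (e i)
  have hbs : HasCompactSupport fun x ↦ ⟪u x, w x⟫_ℝ :=
    hw'.mono fun x hx hx' ↦ hx (by simp [hx'])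
  have hi1 (i : ι) : Integrable (fun x ↦ a i x * ⟪fderiv ℝ u x (e i), w x⟫_ℝ) μ :=
    ((ha i).continuous.mul ((huc i).inner hw.continuous)).integrable_of_hasCompactSupport
      (hw'.mono fun x hx hx' ↦ hx (by simp [hx']))
  have hi2 (i : ι) : Integrable (fun x ↦ a i x * ⟪u x, fderiv ℝ w x (e i)⟫_ℝ) μ :=
    ((ha i).continuous.mul (hu.continuous.inner (hwc i))).integrable_of_hasCompactSupport
      ((hw'.fderiv_apply ℝ (e i)).mono fun x hx hx' ↦ hx (by simp [hx']))
  have hi3 (i : ι) : Integrable (fun x ↦ fderiv ℝ (a i) x (e i) * ⟪u x, w x⟫_ℝ) μ :=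
    ((hc i).mul hb.continuous).integrable_of_hasCompactSupport hbs.mul_left
  have hparts (i : ι) : ∫ x, a i x * ⟪fderiv ℝ u x (e i), w x⟫_ℝ ∂μ
      + ∫ x, a i x * ⟪u x, fderiv ℝ w x (e i)⟫_ℝ ∂μ
      = -∫ x, fderiv ℝ (a i) x (e i) * ⟪u x, w x⟫_ℝ ∂μ := by
    have hprod (x : E) : a i x * ⟪fderiv ℝ u x (e i), w x⟫_ℝ + a i x * ⟪u x, fderiv ℝ w x (e i)⟫_ℝ
        = a i x * fderiv ℝ (fun x ↦ ⟪u x, w x⟫_ℝ) x (e i) := by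
      rw [fderiv_inner_apply ℝ (hu.differentiable one_ne_zero x) (hw.differentiable one_ne_zero x)]
      ring
    have hi := (hi1 i).add (hi2 i)
    rw [← integral_add (hi1 i) (hi2 i)]
    simp only [hprod]
    refine integral_mul_fderiv_eq_neg_fderiv_mul_of_integrable (hi3 i) ?_ ?_
      (fun x _ ↦ (ha i).differentiable one_ne_zero x) fun x _ ↦ hb.differentiable one_ne_zero x
    · simpa only [Pi.add_def, hprod] using hi
    · exact ((ha i).continuous.mul hb.continuous).integrable_of_hasCompactSupport hbs.mul_left
  rw [integral_finsetSum _ fun i _ ↦ hi1 i, integral_finsetSum _ fun i _ ↦ hi2 i,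
    eq_neg_iff_add_eq_zero, ← Finset.sum_add_distrib, Finset.sum_congr rfl fun i _ ↦ hparts i, Finset.sum_neg_distrib,
    ← integral_finsetSum _ fun i _ ↦ hi3 i]
  simp [← Finset.sum_mul, hdiv]

/-- **Bound on the convective term** in three dimensions: if `Ω ⊂ ℝ³` is open with finite
Lebesgue measure `|Ω|`, and `v, w` are smooth vector fields compactly supported in `Ω` with
`div v = 0`, then `|∫ ((v·∇)v)·w| ≤ (4/3)|Ω|^{1/6} ‖∇v‖²_{L²} ‖∇w‖_{L²}`. -/
theorem convective_term_bound_dim3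
    (Ω : Set (EuclideanSpace ℝ (Fin 3))) (hΩopen : IsOpen Ω)
    (hΩvol : volume Ω ≠ ⊤)
    (v w : EuclideanSpace ℝ (Fin 3) → EuclideanSpace ℝ (Fin 3))
    (hv : ContDiff ℝ (⊤ : ℕ∞) v) (hw : ContDiff ℝ (⊤ : ℕ∞) w)
    (hsv : HasCompactSupport v) (hsw : HasCompactSupport w)
    (hsuppv : tsupport v ⊆ Ω) (hsuppw : tsupport w ⊆ Ω)
    (hdiv : ∀ x, (∑ i, vpder3 v i x i) = 0) :
    |∫ x, ∑ i, ∑ j, v x i * vpder3 v i x j * w x j|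
      ≤ (4 / 3) * (volume Ω).toReal ^ ((1 : ℝ) / 6) *
        (∫ x, ∑ i, ∑ j, vpder3 v i x j ^ 2) *
        Real.sqrt (∫ x, ∑ i, ∑ j, vpder3 w i x j ^ 2) := by
  have hv1 : ContDiff ℝ 1 v := hv.of_le (by exact_mod_cast le_top)
  have hw1 : ContDiff ℝ 1 w := hw.of_le (by exact_mod_cast le_top)
  have hnorm (y : EuclideanSpace ℝ (Fin 3)) : ∑ j, y j ^ 2 = ‖y‖ ^ 2 := by
    simp [EuclideanSpace.norm_sq_eq]
  have hinner (x : EuclideanSpace ℝ (Fin 3)) :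
      ∑ i, ∑ j, v x i * vpder3 v i x j * w x j = ∑ i, v x i * ⟪vpder3 v i x, w x⟫_ℝ := by
    simp only [PiLp.inner_apply, RCLike.inner_apply, conj_trivial, Finset.mul_sum]
    congr! 2
    ring
  simp only [hnorm, hinner]
  have hdc (i : Fin 3) : Continuous (vpder3 v i) := continuous_fderiv_apply_const hv1 _
  have hwc (i : Fin 3) : Continuous (vpder3 w i) := continuous_fderiv_apply_const hw1 _
  have hds (i : Fin 3) : HasCompactSupport (vpder3 v i) := hsv.fderiv_apply ℝ _
  set D := ∫ x, ∑ i, ‖vpder3 v i x‖ ^ 2 with hD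
  set W := ∫ x, ∑ i, ‖vpder3 w i x‖ ^ 2
  have hD0 : 0 ≤ D := integral_nonneg fun _ ↦ by positivity
  have hS : ∫ x, ‖v x‖ ^ 6 ≤ (4 / 3 * D) ^ 3 := by
    have hint (i : Fin 3) : Integrable fun x ↦ ‖vpder3 v i x‖ ^ 2 :=
      ((hdc i).norm.pow 2).integrable_of_hasCompactSupport ((hds i).norm_pow two_ne_zero)
    rw [hD, integral_finsetSum _ fun i _ ↦ hint i]
    exact integral_norm_pow_six_le hv1 hsv
  have hL4 : ∫ x, ‖v x‖ ^ 4 ≤ (4 / 3 * (volume Ω).toReal ^ (1 / 6 : ℝ) * D) ^ 2 := by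
    calc
      _ ≤ (∫ x, ‖v x‖ ^ 6) ^ (2 / 3 : ℝ) * (volume Ω).toReal ^ (1 / 3 : ℝ) :=
        integral_norm_pow_four_le hv.continuous hsv hΩvol ((subset_tsupport v).trans hsuppv)
      _ ≤ ((4 / 3 * D) ^ 3) ^ (2 / 3 : ℝ) * (volume Ω).toReal ^ (1 / 3 : ℝ) := by
        gcongr
      _ = _ := by
        have h1 : ((4 / 3 * D) ^ 3) ^ (2 / 3 : ℝ) = (4 / 3 * D) ^ 2 := by
          rw [← Real.rpow_natCast, ← Real.rpow_natCast, ← Real.rpow_mul (by positivity)]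
          norm_num
        have h2 : (volume Ω).toReal ^ (1 / 3 : ℝ) = ((volume Ω).toReal ^ (1 / 6 : ℝ)) ^ 2 := by
          rw [← Real.rpow_natCast, ← Real.rpow_mul ENNReal.toReal_nonneg]
          norm_num
        rw [h1, h2]
        ring
  have hcoord (i : Fin 3) (x) : fderiv ℝ (fun y ↦ v y i) x (EuclideanSpace.single i 1)
      = vpder3 v i x i := by
    have := ((EuclideanSpace.proj i : EuclideanSpace ℝ (Fin 3) →L[ℝ] ℝ).hasFDerivAt.comp x
      (hv1.differentiable one_ne_zero x).hasFDerivAt).fderiv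
    exact DFunLike.congr_fun this (EuclideanSpace.single i 1)
  have hanti : ∫ x, ∑ i, v x i * ⟪vpder3 v i x, w x⟫_ℝ
      = -∫ x, ∑ i, v x i * ⟪v x, vpder3 w i x⟫_ℝ :=
    integral_convective_eq_neg (a := fun i x ↦ v x i) (by fun_prop) hv1 hw1 hsw
      (by simpa only [hcoord] using hdiv)
  have hpoint (x) : |∑ i, v x i * ⟪v x, vpder3 w i x⟫_ℝ|
      ≤ ‖v x‖ ^ 2 * √(∑ i, ‖vpder3 w i x‖ ^ 2) := by
    calc
      _ ≤ √(∑ i, v x i ^ 2) * √(∑ i, ⟪v x, vpder3 w i x⟫_ℝ ^ 2) := by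
        refine Real.abs_le_sqrt (Finset.sum_mul_sq_le_sq_mul_sq _ _ _) |>.trans_eq ?_
        rw [Real.sqrt_mul (by positivity)]
      _ ≤ ‖v x‖ * √(∑ i, (‖v x‖ * ‖vpder3 w i x‖) ^ 2) := by
        rw [hnorm, Real.sqrt_sq (norm_nonneg _)]
        gcongr _ * √(∑ i, ?_) with i
        exact sq_le_sq.mpr ((abs_real_inner_le_norm _ _).trans (le_abs_self _))
      _ = _ := by
        simp only [mul_pow, ← Finset.mul_sum]
        rw [Real.sqrt_mul (sq_nonneg _), Real.sqrt_sq (norm_nonneg _)]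
        ring
  have hgc : Continuous fun x ↦ √(∑ i, ‖vpder3 w i x‖ ^ 2) := by fun_prop
  have hgs : HasCompactSupport fun x ↦ √(∑ i, ‖vpder3 w i x‖ ^ 2) := by
    refine (hsw.fderiv ℝ).mono fun x hx hx' ↦ hx ?_
    simp [vpder3, hx']
  have hvs : HasCompactSupport fun x ↦ ‖v x‖ ^ 2 := hsv.norm_pow two_ne_zero
  have hCS := sq_integral_mul_le (μ := volume) (f := fun x ↦ ‖v x‖ ^ 2)
    (hv.continuous.norm.pow 2) hgc hvs hgs (fun _ ↦ sq_nonneg _) fun _ ↦ Real.sqrt_nonneg _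
  have hsq (x) : √(∑ i, ‖vpder3 w i x‖ ^ 2) ^ 2 = ∑ i, ‖vpder3 w i x‖ ^ 2 :=
    Real.sq_sqrt (by positivity)
  simp only [hsq, ← pow_mul, Nat.reduceMul] at hCS
  rw [hanti, abs_neg]
  calc
    _ ≤ ∫ x, ‖v x‖ ^ 2 * √(∑ i, ‖vpder3 w i x‖ ^ 2) := by
      refine abs_integral_le_integral_abs.trans
        (integral_mono_of_nonneg (ae_of_all _ fun _ ↦ abs_nonneg _) ?_ (ae_of_all _ hpoint))
      exact ((hv.continuous.norm.pow 2).mul hgc).integrable_of_hasCompactSupport hgs.mul_left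
    _ ≤ √((∫ x, ‖v x‖ ^ 4) * W) := Real.le_sqrt_of_sq_le hCS
    _ ≤ √((4 / 3 * (volume Ω).toReal ^ (1 / 6 : ℝ) * D) ^ 2 * W) := by gcongr
    _ = _ := by rw [Real.sqrt_mul (sq_nonneg _), Real.sqrt_sq (by positivity)]
end
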